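/- Let g(x) = (x⁴ + (4/3)x³ + (2/3)x² − 1/11)²·(x⁴ + (22/3)x³ − (8/3)x² − 2x + 13/11) − t·(x² − 3/11)³·(x³ + x² + (1/11)x − 1/11), a polynomial of degree 12 in x with coefficients in ℚ(t). Then the Galois group of (the splitting field of) g over ℚ(t) is a simple group of cardinality 7920 (i.e., it is isomorphic to the Mathieu group M₁₁). -/

import Mathlib

open Polynomial

/-- The generator `t` of the rational function field `ℚ(t)`. -/
noncomputable def t : RatFunc ℚ := RatFunc.X

/-- `g(x) = (x⁴ + (4/3)x³ + (2/3)x² − 1/11)² (x⁴ + (22/3)x³ − (8/3)x² − 2x + 13/11)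
  − t (x² − 3/11)³ (x³ + x² + (1/11)x − 1/11)` over `ℚ(t)`. -/
noncomputable def g : Polynomial (RatFunc ℚ) :=
  (X ^ 4 + C (4 / 3 : RatFunc ℚ) * X ^ 3 + C (2 / 3 : RatFunc ℚ) * X ^ 2 -
      C (1 / 11 : RatFunc ℚ)) ^ 2 *
    (X ^ 4 + C (22 / 3 : RatFunc ℚ) * X ^ 3 - C (8 / 3 : RatFunc ℚ) * X ^ 2 - 2 * X +
      C (13 / 11 : RatFunc ℚ)) -
    C t * ((X ^ 2 - C (3 / 11 : RatFunc ℚ)) ^ 3 *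
      (X ^ 3 + X ^ 2 + C (1 / 11 : RatFunc ℚ) * X - C (1 / 11 : RatFunc ℚ)))

set_option linter.unusedSectionVars false
namespace M11
open MulAction

section core
variable {G X : Type*} [Group G] [Finite G] [MulAction G X] [FaithfulSMul G X]
  [Fintype X] [DecidableEq X]

lemma card_modEq (g : G) (l : ℕ) [Fact l.Prime] (hg : g ^ l = 1) (S : Finset X)
    (hS : ∀ x ∈ S, g • x ∈ S) :
    S.card ≡ (S.filter (fun x => g • x = x)).card [MOD l] := by
  classical
  let f : Function.End S := fun x => ⟨g • x.1, hS x.1 x.2⟩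
  have hf : ∀ n : ℕ, ∀ x : S, ((f ^ n) x).1 = g ^ n • x.1 := by
    intro n
    induction n with
    | zero => intro x; simp; rfl
    | succ k ih =>
      intro x
      rw [pow_succ', pow_succ', mul_smul, ← ih]; rfl
  have h1 : f ^ (l ^ 1) = 1 := by
    funext x
    apply Subtype.ext
    rw [hf, pow_one, hg, one_smul]; rfl
  have := Equiv.Perm.card_fixedPoints_modEq (p := l) (n := 1) h1
  rw [Fintype.card_coe] at this
  refine this.trans ?_
  have e : Fintype.card (Function.fixedPoints f) = (S.filter (fun x => g • x = x)).card := by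
    rw [← Fintype.card_coe]
    refine Fintype.card_congr ⟨fun x => ⟨x.1.1, ?_⟩, fun x => ⟨⟨x.1, ?_⟩, ?_⟩, ?_, ?_⟩
    · rw [Finset.mem_filter]; exact ⟨x.1.2, congrArg Subtype.val x.2⟩
    · exact (Finset.mem_filter.1 x.2).1
    · exact Subtype.ext (Finset.mem_filter.1 x.2).2
    · intro x; rfl
    · intro x; rfl
  rw [e]

open Classical in
noncomputable def orb (L : Subgroup G) (x : X) : Finset X :=
  Finset.univ.filter (fun y => ∃ g ∈ L, g • x = y)

lemma mem_orb {L : Subgroup G} {x y : X} : y ∈ orb L x ↔ ∃ g ∈ L, g • x = y := by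
  simp [orb]

lemma self_mem_orb (L : Subgroup G) (x : X) : x ∈ orb L x := mem_orb.2 ⟨1, L.one_mem, one_smul _ _⟩

lemma smul_mem_orb {L : Subgroup G} {x y : X} {g : G} (hg : g ∈ L) (hy : y ∈ orb L x) :
    g • y ∈ orb L x := by
  obtain ⟨k, hk, rfl⟩ := mem_orb.1 hy
  exact mem_orb.2 ⟨g * k, L.mul_mem hg hk, mul_smul _ _ _⟩

lemma orb_os (L : Subgroup G) (x : X) :
    Nat.card L = (orb L x).card * Nat.card (L ⊓ stabilizer G x : Subgroup G) := by
  classical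
  have h1 : Nat.card (orbit L x) = (orb L x).card := by
    rw [Nat.card_coe_set_eq, ← Set.ncard_coe_finset]
    congr 1
    ext y
    rw [Finset.mem_coe, mem_orb]
    constructor
    · rintro ⟨k, rfl⟩; exact ⟨k.1, k.2, rfl⟩
    · rintro ⟨k, hk, rfl⟩; exact ⟨⟨k, hk⟩, rfl⟩
  have h2 : Nat.card (stabilizer L x) = Nat.card (L ⊓ stabilizer G x : Subgroup G) := by
    refine Nat.card_congr ⟨fun g => ⟨g.1.1, g.1.2, g.2⟩, fun g => ⟨⟨g.1, g.2.1⟩, g.2.2⟩, ?_, ?_⟩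
    · intro x; rfl
    · intro x; rfl
  rw [← h1, ← h2, ← Nat.card_prod]
  exact (Nat.card_congr (orbitProdStabilizerEquivGroup L x)).symm


lemma orb_modEq (L : Subgroup G) (x : X) (g : G) (l : ℕ) [Fact l.Prime] (hg : g ^ l = 1)
    (hL : g ∈ L) : (orb L x).card ≡ ((orb L x).filter (fun x => g • x = x)).card [MOD l] :=
  card_modEq g l hg _ (fun _ hy => smul_mem_orb hL hy)

/-- two permutations agreeing -/
lemma ne_one_exists {g : G} (hg : g ≠ 1) : ∃ x : X, g • x ≠ x := by
  by_contra! h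
  exact hg (FaithfulSMul.eq_of_smul_eq_smul (α := X) (fun x => by rw [h x, one_smul]))

variable (G X) in
structure Elts : Prop where
  card : Fintype.card X = 12
  s : ∃ σ : G, σ ^ 11 = 1 ∧ σ ≠ 1
  r : ∃ ρ : G, ρ ^ 5 = 1 ∧ (Finset.univ.filter (fun x : X => ρ • x = x)).card = 2
  th : ∃ θ : G, θ ^ 3 = 1 ∧ (Finset.univ.filter (fun x : X => θ • x = x)).card = 3
  k : ∃ κ : G, κ ^ 4 = 1 ∧ κ ^ 2 ≠ 1 ∧ (∀ x : X, κ • x ≠ x) ∧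
    3 ≤ (Finset.univ.filter (fun x : X => κ ^ 2 • x = x)).card

variable (h : Elts G X)
include h

lemma Elts.sig : ∃ σ : G, ∃ p : X, σ ^ 11 = 1 ∧ ∀ x, σ • x = x ↔ x = p := by
  obtain ⟨σ, h1, h2⟩ := h.s
  have : Fact (Nat.Prime 11) := ⟨by norm_num⟩
  have h3 := card_modEq σ 11 h1 (Finset.univ : Finset X) (fun _ _ => Finset.mem_univ _)
  rw [Finset.card_univ, h.card] at h3
  obtain ⟨x, hx⟩ := ne_one_exists (X := X) h2
  have h4 : (Finset.univ.filter (fun x : X => σ • x = x)).card < 12 := by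
    rw [← h.card, ← Finset.card_univ]
    apply Finset.card_lt_card
    rw [Finset.filter_ssubset]
    exact ⟨x, Finset.mem_univ _, hx⟩
  have h5 : (Finset.univ.filter (fun x : X => σ • x = x)).card = 1 := by
    unfold Nat.ModEq at h3; omega
  obtain ⟨p, hp⟩ := Finset.card_eq_one.1 h5
  refine ⟨σ, p, h1, fun x => ?_⟩
  have := Finset.ext_iff.1 hp x
  simpa using this

lemma Elts.trans1 (x y : X) : ∃ g : G, g • x = y := by
  obtain ⟨σ, p, h1, h2⟩ := h.sig
  obtain ⟨κ, -, -, hk, -⟩ := h.k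
  have : Fact (Nat.Prime 11) := ⟨by norm_num⟩
  have h3 := orb_modEq ⊤ p σ 11 h1 (Subgroup.mem_top _)
  have h4 : (orb (⊤ : Subgroup G) p).filter (fun x => σ • x = x) = {p} := by
    ext x
    simp only [Finset.mem_filter, h2, Finset.mem_singleton]
    constructor
    · exact fun h => h.2
    · rintro rfl; exact ⟨self_mem_orb _ _, rfl⟩
  rw [h4, Finset.card_singleton] at h3
  have h5 : (orb (⊤ : Subgroup G) p).card ≤ 12 := by
    rw [← h.card]; exact Finset.card_le_univ _
  have h6 : 1 < (orb (⊤ : Subgroup G) p).card := by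
    rw [Finset.one_lt_card]
    exact ⟨κ • p, mem_orb.2 ⟨κ, Subgroup.mem_top _, rfl⟩, p, self_mem_orb _ _, hk p⟩
  have h7 : orb (⊤ : Subgroup G) p = Finset.univ := by
    rw [← Finset.card_eq_iff_eq_univ, h.card]
    unfold Nat.ModEq at h3; omega
  obtain ⟨a, -, ha⟩ := mem_orb.1 (h7 ▸ Finset.mem_univ x)
  obtain ⟨b, -, hb⟩ := mem_orb.1 (h7 ▸ Finset.mem_univ y)
  exact ⟨b * a⁻¹, by rw [mul_smul, ← ha, inv_smul_smul, hb]⟩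

lemma Elts.trans2 {x y x' y' : X} (hxy : x ≠ y) (hxy' : x' ≠ y') :
    ∃ g : G, g • x = x' ∧ g • y = y' := by
  obtain ⟨σ, p, h1, h2⟩ := h.sig
  have : Fact (Nat.Prime 11) := ⟨by norm_num⟩
  have key : ∀ q q' : X, q ≠ p → q' ≠ p → ∃ g : G, g • p = p ∧ g • q = q' := by
    intro q q' hq hq'
    have h3 := orb_modEq (stabilizer G p) q σ 11 h1 (by rw [mem_stabilizer_iff, h2])
    have hp : p ∉ orb (stabilizer G p) q := by
      intro hp
      obtain ⟨k, hk, hkq⟩ := mem_orb.1 hp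
      rw [mem_stabilizer_iff] at hk
      apply hq
      rw [← hk] at hkq
      exact smul_left_cancel _ hkq
    have h4 : (orb (stabilizer G p) q).filter (fun x => σ • x = x) = ∅ := by
      rw [Finset.filter_eq_empty_iff]
      intro x hx hs
      rw [h2] at hs
      exact hp (hs ▸ hx)
    rw [h4, Finset.card_empty] at h3
    have h5 : 0 < (orb (stabilizer G p) q).card := Finset.card_pos.2 ⟨q, self_mem_orb _ _⟩
    have hsub : orb (stabilizer G p) q ⊆ Finset.univ.erase p := by
      intro x hx
      rw [Finset.mem_erase]
      exact ⟨fun e => hp (e ▸ hx), Finset.mem_univ _⟩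
    have hc : (Finset.univ.erase p).card = 11 := by
      rw [Finset.card_erase_of_mem (Finset.mem_univ _), Finset.card_univ, h.card]
    have h6 : orb (stabilizer G p) q = Finset.univ.erase p := by
      apply Finset.eq_of_subset_of_card_le hsub
      rw [hc]
      unfold Nat.ModEq at h3; omega
    obtain ⟨k, hk, hkq⟩ := mem_orb.1 (h6 ▸ Finset.mem_erase.2 ⟨hq', Finset.mem_univ q'⟩)
    exact ⟨k, hk, hkq⟩
  obtain ⟨a, ha⟩ := h.trans1 x p
  obtain ⟨b, hb⟩ := h.trans1 x' p
  obtain ⟨k, hk1, hk2⟩ := key (a • y) (b • y')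
    (fun e => hxy (smul_left_cancel a (ha.trans e.symm)))
    (fun e => hxy' (smul_left_cancel b (hb.trans e.symm)))
  refine ⟨b⁻¹ * k * a, ?_, ?_⟩
  · rw [mul_smul, mul_smul, ha, hk1, ← hb, inv_smul_smul]
  · rw [mul_smul, mul_smul, hk2, inv_smul_smul]

lemma Elts.theta2 {p q : X} (hpq : p ≠ q) : ∃ θ : G, ∃ r : X, θ ^ 3 = 1 ∧ r ≠ p ∧ r ≠ q ∧
    ∀ x, θ • x = x ↔ (x = p ∨ x = q ∨ x = r) := by
  obtain ⟨θ, h1, h2⟩ := h.th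
  obtain ⟨a, b, c, hab, hac, hbc, habc⟩ := Finset.card_eq_three.1 h2
  obtain ⟨k, hka, hkb⟩ := h.trans2 hab hpq
  refine ⟨k * θ * k⁻¹, k • c, ?_, ?_, ?_, ?_⟩
  · rw [conj_pow, h1]; group
  · rw [← hka]; exact fun e => hac (smul_left_cancel k e).symm
  · rw [← hkb]; exact fun e => hbc (smul_left_cancel k e).symm
  · intro x
    have := Finset.ext_iff.1 habc (k⁻¹ • x)
    simp only [Finset.mem_filter, Finset.mem_univ, true_and, Finset.mem_insert,
      Finset.mem_singleton, inv_smul_eq_iff, hka, hkb] at this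
    rw [← this, mul_smul, mul_smul, eq_inv_smul_iff]

lemma Elts.trans3' {p q r r' : X} (hpq : p ≠ q) (hr : r ≠ p ∧ r ≠ q) (hr' : r' ≠ p ∧ r' ≠ q) :
    ∃ g : G, g • p = p ∧ g • q = q ∧ g • r = r' := by
  have : Fact (Nat.Prime 5) := ⟨by norm_num⟩
  have : Fact (Nat.Prime 3) := ⟨by norm_num⟩
  obtain ⟨ρ, h1, h2⟩ := h.r
  obtain ⟨a, b, hab, hfix⟩ := Finset.card_eq_two.1 h2
  obtain ⟨k, hka, hkb⟩ := h.trans2 hpq hab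
  have key : ∀ r r' : X, (r ≠ a ∧ r ≠ b) → (r' ≠ a ∧ r' ≠ b) →
      ∃ g : G, g • a = a ∧ g • b = b ∧ g • r = r' := by
    clear hr hr' r r'
    intro r r' hr hr'
    let L : Subgroup G := stabilizer G a ⊓ stabilizer G b
    have hρ : ∀ x, ρ • x = x ↔ x = a ∨ x = b := fun x => by
      simpa using Finset.ext_iff.1 hfix x
    have haO : ∀ c, (∀ g ∈ L, g • c = c) → r ≠ c → c ∉ orb L r := by
      intro c hc hrc hO
      obtain ⟨g, hg, hgr⟩ := mem_orb.1 hO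
      apply hrc
      have := hc g hg
      rw [← hgr] at this
      rw [← hgr]
      exact (smul_left_cancel g this).symm
    have ha : a ∉ orb L r := haO a (fun g hg => hg.1) hr.1
    have hb : b ∉ orb L r := haO b (fun g hg => hg.2) hr.2
    have h3 := orb_modEq L r ρ 5 h1 ⟨by simp [hρ], by simp [hρ]⟩
    have h4 : (orb L r).filter (fun x => ρ • x = x) = ∅ := by
      rw [Finset.filter_eq_empty_iff]
      intro x hx hs
      rw [hρ] at hs
      rcases hs with rfl | rfl
      exacts [ha hx, hb hx]
    rw [h4, Finset.card_empty] at h3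
    obtain ⟨θ, c, ht, hca, hcb, hθ⟩ := h.theta2 hab
    have h5 := orb_modEq L r θ 3 ht ⟨by simp [hθ], by simp [hθ]⟩
    have h6 : ((orb L r).filter (fun x => θ • x = x)).card ≤ 1 := by
      rw [Finset.card_le_one]
      simp only [Finset.mem_filter, hθ]
      rintro x ⟨hx, rfl | rfl | rfl⟩ y ⟨hy, rfl | rfl | rfl⟩ <;> first | rfl | (exfalso; tauto)
    have h7 : 0 < (orb L r).card := Finset.card_pos.2 ⟨r, self_mem_orb _ _⟩
    have hsub : orb L r ⊆ (Finset.univ.erase a).erase b := by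
      intro x hx
      rw [Finset.mem_erase, Finset.mem_erase]
      exact ⟨fun e => hb (e ▸ hx), fun e => ha (e ▸ hx), Finset.mem_univ _⟩
    have hc : ((Finset.univ.erase a).erase b).card = 10 := by
      rw [Finset.card_erase_of_mem (by simp [hab.symm]),
        Finset.card_erase_of_mem (Finset.mem_univ _), Finset.card_univ, h.card]
    have h8 : orb L r = (Finset.univ.erase a).erase b := by
      apply Finset.eq_of_subset_of_card_le hsub
      rw [hc]
      unfold Nat.ModEq at h3 h5
      omega
    obtain ⟨k, hk, hkq⟩ := mem_orb.1 (h8 ▸ (by simp [hr'] : r' ∈ (Finset.univ.erase a).erase b))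
    exact ⟨k, hk.1, hk.2, hkq⟩
  have aux : ∀ r, r ≠ p ∧ r ≠ q → k • r ≠ a ∧ k • r ≠ b := by
    intro r hr
    rw [← hka, ← hkb]
    exact ⟨fun e => hr.1 (smul_left_cancel k e), fun e => hr.2 (smul_left_cancel k e)⟩
  obtain ⟨m, hm1, hm2, hm3⟩ := key _ _ (aux r hr) (aux r' hr')
  refine ⟨k⁻¹ * m * k, ?_, ?_, ?_⟩
  · rw [mul_smul, mul_smul, hka, hm1, ← hka, inv_smul_smul]
  · rw [mul_smul, mul_smul, hkb, hm2, ← hkb, inv_smul_smul]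
  · rw [mul_smul, mul_smul, hm3, inv_smul_smul]

lemma Elts.trans3 {p q r p' q' r' : X} (hpq : p ≠ q) (hr : r ≠ p ∧ r ≠ q) (hpq' : p' ≠ q')
    (hr' : r' ≠ p' ∧ r' ≠ q') :
    ∃ g : G, g • p = p' ∧ g • q = q' ∧ g • r = r' := by
  obtain ⟨k, rfl, rfl⟩ := h.trans2 hpq hpq'
  obtain ⟨m, h1, h2, h3⟩ := h.trans3' (r := k • r) (r' := r') hpq'
    (by simpa using hr) hr'
  exact ⟨m * k, by rw [mul_smul, h1], by rw [mul_smul, h2], by rw [mul_smul, h3]⟩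

end core
end M11

namespace M11
open MulAction
open scoped Pointwise

section blocks
variable {G X : Type*} [Group G] [Finite G] [MulAction G X] [FaithfulSMul G X]
  [Fintype X] [DecidableEq X]

variable (G) in
structure Blocks (S : Finset (Finset X)) : Prop where
  ne : S.Nonempty
  le : S.card ≤ 22
  six : ∀ B ∈ S, B.card = 6
  compl : ∀ B ∈ S, Bᶜ ∈ S
  inv : ∀ (g : G), ∀ B ∈ S, g • B ∈ S

def rr (S : Finset (Finset X)) (T : Finset X) : ℕ := (S.filter (fun B => T ⊆ B)).card

lemma rr_sum (S : Finset (Finset X)) (h6 : ∀ B ∈ S, B.card = 6) (T : Finset X) :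
    ∑ y ∈ Tᶜ, rr S (insert y T) = rr S T * (6 - T.card) := by
  unfold rr
  have := Finset.sum_card_bipartiteAbove_eq_sum_card_bipartiteBelow
    (s := Tᶜ) (t := S.filter (fun B => T ⊆ B)) (fun y B => y ∈ B)
  unfold Finset.bipartiteAbove Finset.bipartiteBelow at this
  have e : ∀ y, S.filter (fun B => insert y T ⊆ B) =
      (S.filter (fun B => T ⊆ B)).filter (fun B => y ∈ B) := by
    intro y; ext B
    simp only [Finset.mem_filter, Finset.insert_subset_iff]; tauto
  simp_rw [e]
  rw [this, Finset.card_eq_sum_ones, Finset.sum_mul]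
  apply Finset.sum_congr rfl
  intro B hB
  rw [Finset.mem_filter] at hB
  rw [one_mul, ← h6 B hB.1, ← Finset.card_sdiff_of_subset hB.2]
  congr 1
  ext y
  simp [and_comm]

lemma sum_inter (S : Finset (Finset X)) (B : Finset X) :
    ∑ C ∈ S, (B ∩ C).card = ∑ x ∈ B, rr S {x} := by
  have := Finset.sum_card_bipartiteAbove_eq_sum_card_bipartiteBelow
    (s := B) (t := S) (fun y B => y ∈ B)
  unfold Finset.bipartiteAbove Finset.bipartiteBelow at this
  unfold rr
  simp only [Finset.singleton_subset_iff]
  rw [this]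
  simp only [Finset.filter_mem_eq_inter]

lemma sum_inter_sq (S : Finset (Finset X)) (B : Finset X) :
    ∑ C ∈ S, (B ∩ C).card ^ 2 = ∑ x ∈ B, ∑ y ∈ B, rr S {x, y} := by
  have := Finset.sum_card_bipartiteAbove_eq_sum_card_bipartiteBelow
    (s := B ×ˢ B) (t := S) (fun y B => y.1 ∈ B ∧ y.2 ∈ B)
  unfold Finset.bipartiteAbove Finset.bipartiteBelow at this
  unfold rr
  rw [← Finset.sum_product']
  simp only [Finset.insert_subset_iff, Finset.singleton_subset_iff]
  rw [this]
  apply Finset.sum_congr rfl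
  intro C hC
  rw [sq, ← Finset.card_product]
  congr 1
  ext x
  simp only [Finset.mem_product, Finset.mem_inter, Finset.mem_filter]; tauto

variable {S : Finset (Finset X)} (b : Blocks G S)
include b

lemma Blocks.rr_smul (g : G) (T : Finset X) : rr S (g • T) = rr S T := by
  unfold rr
  refine Finset.card_bij' (fun B _ => g⁻¹ • B) (fun B _ => g • B) ?_ ?_ ?_ ?_
  · intro B hB
    rw [Finset.mem_filter] at *
    refine ⟨b.inv _ _ hB.1, ?_⟩
    rw [Finset.subset_smul_finset_iff, inv_inv]; exact hB.2
  · intro B hB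
    rw [Finset.mem_filter] at *
    refine ⟨b.inv _ _ hB.1, ?_⟩
    exact Finset.smul_finset_subset_smul_finset hB.2
  · intro B _; simp
  · intro B _; simp

variable (h : Elts G X)
include h

lemma Blocks.counts : S.card = 22 ∧ (∀ x, rr S {x} = 11) ∧ (∀ x y, x ≠ y → rr S {x, y} = 5) ∧
    (∀ x y z, x ≠ y → x ≠ z → y ≠ z → rr S {x, y, z} = 2) := by
  have hc2 : ∀ T : Finset X, Tᶜ.card = 12 - T.card := fun T => by
    rw [Finset.card_compl, h.card]
  obtain ⟨p, q, r, hpq, hpr, hqr⟩ : ∃ p q r : X, p ≠ q ∧ p ≠ r ∧ q ≠ r := by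
    rw [← Fintype.two_lt_card_iff, h.card]; norm_num
  have e1 : ∀ x, rr S {x} = rr S {p} := by
    intro x
    obtain ⟨g, rfl⟩ := h.trans1 p x
    rw [← b.rr_smul g {p}, Finset.smul_finset_singleton]
  have e2 : ∀ x y, x ≠ y → rr S {x, y} = rr S {p, q} := by
    intro x y hxy
    obtain ⟨g, rfl, rfl⟩ := h.trans2 hpq hxy
    rw [← b.rr_smul g {p, q}, Finset.smul_finset_insert, Finset.smul_finset_singleton]
  have e3 : ∀ x y z, x ≠ y → x ≠ z → y ≠ z → rr S {x, y, z} = rr S {p, q, r} := by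
    intro x y z hxy hxz hyz
    obtain ⟨g, rfl, rfl, rfl⟩ := h.trans3 hpq ⟨hpr.symm, hqr.symm⟩ hxy ⟨hxz.symm, hyz.symm⟩
    rw [← b.rr_smul g {p, q, r}, Finset.smul_finset_insert, Finset.smul_finset_insert,
      Finset.smul_finset_singleton]
  have s0 := rr_sum S b.six ∅
  have s1 := rr_sum S b.six {p}
  have s2 := rr_sum S b.six {p, q}
  rw [Finset.sum_congr rfl (g := fun _ => rr S {p}) (by
    intro y hy; rw [insert_empty_eq]; exact e1 y)] at s0
  rw [Finset.sum_congr rfl (g := fun _ => rr S {p, q}) (by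
    intro y hy; exact e2 y p (by simpa using hy))] at s1
  rw [Finset.sum_congr rfl (g := fun _ => rr S {p, q, r}) (by
    intro y hy
    simp only [Finset.mem_compl, Finset.mem_insert, Finset.mem_singleton, not_or] at hy
    exact e3 y p q hy.1 hy.2 hpq)] at s2
  have hS : rr S ∅ = S.card := by unfold rr; simp
  rw [Finset.sum_const, hc2, Finset.card_empty, hS, smul_eq_mul] at s0
  rw [Finset.sum_const, hc2, Finset.card_singleton, smul_eq_mul] at s1
  rw [Finset.sum_const, hc2, Finset.card_pair hpq, smul_eq_mul] at s2
  have hpos : 0 < S.card := b.ne.card_pos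
  have hle := b.le
  have : S.card = 22 ∧ rr S {p} = 11 ∧ rr S {p, q} = 5 ∧ rr S {p, q, r} = 2 := by omega
  refine ⟨this.1, fun x => (e1 x).trans this.2.1, fun x y hxy => (e2 x y hxy).trans this.2.2.1,
    fun x y z h1 h2 h3 => (e3 x y z h1 h2 h3).trans this.2.2.2⟩

lemma Blocks.inter {B C : Finset X} (hB : B ∈ S) (hC : C ∈ S) (h1 : C ≠ B) (h2 : C ≠ Bᶜ) :
    (B ∩ C).card = 3 := by
  obtain ⟨c0, c1, c2, -⟩ := b.counts h
  have s1 := sum_inter S B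
  have s2 := sum_inter_sq S B
  rw [Finset.sum_congr rfl (fun x _ => c1 x), Finset.sum_const, b.six B hB] at s1
  have : ∀ x ∈ B, ∑ y ∈ B, rr S {x, y} = 36 := by
    intro x hx
    rw [← Finset.add_sum_erase _ _ hx, Finset.pair_eq_singleton, c1,
      Finset.sum_congr rfl (g := fun _ => 5) (fun y hy => c2 x y (Finset.ne_of_mem_erase hy).symm),
      Finset.sum_const, Finset.card_erase_of_mem hx, b.six B hB]
    rfl
  rw [Finset.sum_congr rfl this, Finset.sum_const, b.six B hB] at s2
  have s3 : ∑ C ∈ S, (((B ∩ C).card : ℤ) - 3) ^ 2 = 18 := by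
    have e : ∀ C : Finset X, (((B ∩ C).card : ℤ) - 3) ^ 2 =
      (((B ∩ C).card ^ 2 : ℕ) : ℤ) - 6 * (((B ∩ C).card : ℕ) : ℤ) + 9 := by intro C; push_cast; ring
    rw [Finset.sum_congr rfl (fun C _ => e C), Finset.sum_add_distrib, Finset.sum_sub_distrib,
      ← Finset.mul_sum, ← Nat.cast_sum, ← Nat.cast_sum, s1, s2, Finset.sum_const, c0]
    norm_num
  have hne : Bᶜ ≠ B := by
    intro e
    have : (B ∩ Bᶜ) = ∅ := Finset.inter_compl B
    rw [e, Finset.inter_self] at this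
    have := b.six B hB
    simp_all
  rw [← Finset.add_sum_erase _ _ hB, ← Finset.add_sum_erase _ _
    (Finset.mem_erase.2 ⟨hne, b.compl B hB⟩),
    ← Finset.add_sum_erase _ _ (Finset.mem_erase.2 ⟨h2, Finset.mem_erase.2 ⟨h1, hC⟩⟩),
    Finset.inter_self, Finset.inter_compl, b.six B hB, Finset.card_empty] at s3
  have hnn := Finset.sum_nonneg (s := ((S.erase B).erase Bᶜ).erase C)
    (f := fun C => (((B ∩ C).card : ℤ) - 3) ^ 2) (fun _ _ => sq_nonneg _)
  have : (((B ∩ C).card : ℤ) - 3) ^ 2 = 0 := by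
    apply le_antisymm _ (sq_nonneg _)
    norm_num at s3
    linarith
  have := pow_eq_zero_iff (two_ne_zero) |>.1 this
  omega

lemma Blocks.eq_of_four {B C : Finset X} (hB : B ∈ S) (hC : C ∈ S) (h4 : 4 ≤ (B ∩ C).card) :
    C = B := by
  by_contra h1
  by_cases h2 : C = Bᶜ
  · rw [h2, Finset.inter_compl] at h4; simp at h4
  · have := b.inter h hB hC h1 h2; omega

lemma Blocks.exists_other {B : Finset X} (hB : B ∈ S) {x y z : X} (hxy : x ≠ y) (hxz : x ≠ z)
    (hyz : y ≠ z) (hx : x ∈ B) (hy : y ∈ B) (hz : z ∈ B) :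
    ∃ C ∈ S, C ≠ B ∧ B ∩ C = {x, y, z} ∧ ∀ D ∈ S, D ≠ B → {x, y, z} ⊆ D → D = C := by
  have h2 := (b.counts h).2.2.2 x y z hxy hxz hyz
  unfold rr at h2
  have hT : ({x, y, z} : Finset X) ⊆ B := by
    simp [Finset.insert_subset_iff, hx, hy, hz]
  have h3 : ((S.filter (fun B => ({x, y, z} : Finset X) ⊆ B)).erase B).card = 1 := by
    rw [Finset.card_erase_of_mem (Finset.mem_filter.2 ⟨hB, hT⟩), h2]
  obtain ⟨C, hC⟩ := Finset.card_eq_one.1 h3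
  have hC' : ∀ D, (D ≠ B ∧ D ∈ S ∧ {x, y, z} ⊆ D) ↔ D = C := by
    intro D
    simpa using Finset.ext_iff.1 hC D
  obtain ⟨m1, m2, m3⟩ := (hC' C).2 rfl
  refine ⟨C, m2, m1, ?_, fun D d1 d2 d3 => (hC' D).1 ⟨d2, d1, d3⟩⟩
  symm
  apply Finset.eq_of_subset_of_card_le (Finset.subset_inter hT m3)
  rw [Finset.card_eq_three.2 ⟨x, y, z, hxy, hxz, hyz, rfl⟩]
  by_contra! h4
  exact m1 (b.eq_of_four h hB m2 h4)

end blocks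
end M11

namespace M11
open MulAction
open scoped Pointwise

section fix4
variable {G X : Type*} [Group G] [Finite G] [MulAction G X] [FaithfulSMul G X]
  [Fintype X] [DecidableEq X]

lemma two_of_four (S : Finset (Finset X)) (D : Finset X) (hS : S.card = 4) (hD : D.card = 6)
    (h1 : ∀ E ∈ S, (D ∩ E).card = 3) (h2 : ∀ E ∈ S, ∀ F ∈ S, E ≠ F → (D ∩ (E ∩ F)).card = 1)
    (x : X) (hx : x ∈ D) : ∃ E ∈ S, ∃ F ∈ S, E ≠ F ∧ x ∈ E ∧ x ∈ F := by
  have s1 := sum_inter S D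
  rw [Finset.sum_congr rfl h1, Finset.sum_const, hS] at s1
  have s2 : ∑ x ∈ D, rr S {x} ^ 2 = 24 := by
    have := Finset.sum_card_bipartiteAbove_eq_sum_card_bipartiteBelow
      (s := D) (t := S ×ˢ S) (fun y B => y ∈ B.1 ∧ y ∈ B.2)
    unfold Finset.bipartiteAbove Finset.bipartiteBelow at this
    have e1 : ∀ x ∈ D, rr S {x} ^ 2 =
        ((S ×ˢ S).filter (fun B => x ∈ B.1 ∧ x ∈ B.2)).card := by
      intro x _
      unfold rr
      rw [sq, ← Finset.card_product]
      congr 1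
      ext B
      simp only [Finset.mem_product, Finset.mem_filter, Finset.singleton_subset_iff]; tauto
    rw [Finset.sum_congr rfl e1, this, Finset.sum_product]
    have e2 : ∀ E ∈ S, ∑ F ∈ S, (D.filter (fun x => x ∈ E ∧ x ∈ F)).card = 6 := by
      intro E hE
      have e3 : ∀ F : Finset X, D.filter (fun x => x ∈ E ∧ x ∈ F) = D ∩ (E ∩ F) := by
        intro F; ext x; simp
      simp only [e3]
      rw [← Finset.add_sum_erase _ _ hE, Finset.inter_self, h1 E hE,
        Finset.sum_congr rfl (g := fun _ => 1) (fun F hF => h2 E hE F (Finset.mem_of_mem_erase hF)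
          (Finset.ne_of_mem_erase hF).symm), Finset.sum_const, Finset.card_erase_of_mem hE, hS]
      rfl
    rw [Finset.sum_congr rfl e2, Finset.sum_const, hS]
    rfl
  have s3 : ∑ x ∈ D, ((rr S {x} : ℤ) - 2) ^ 2 = 0 := by
    have e : ∀ x : X, ((rr S {x} : ℤ) - 2) ^ 2 =
      ((rr S {x} ^ 2 : ℕ) : ℤ) - 4 * ((rr S {x} : ℕ) : ℤ) + 4 := by intro C; push_cast; ring
    rw [Finset.sum_congr rfl (fun C _ => e C), Finset.sum_add_distrib, Finset.sum_sub_distrib,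
      ← Finset.mul_sum, ← Nat.cast_sum, ← Nat.cast_sum, ← s1, s2, Finset.sum_const, hD]
    norm_num
  rw [Finset.sum_eq_zero_iff_of_nonneg (fun _ _ => sq_nonneg _)] at s3
  have := pow_eq_zero_iff (two_ne_zero) |>.1 (s3 x hx)
  have h5 : 1 < rr S {x} := by omega
  unfold rr at h5
  obtain ⟨E, hE, F, hF, hEF⟩ := Finset.one_lt_card.1 h5
  simp only [Finset.mem_filter, Finset.singleton_subset_iff] at hE hF
  exact ⟨E, hE.1, F, hF.1, hEF, hE.2, hF.2⟩

variable {S : Finset (Finset X)} (b : Blocks G S) (h : Elts G X)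
include b h

lemma Blocks.fix4 {B Q : Finset X} (hB : B ∈ S) (hQ : Q ⊆ B) (hQ4 : Q.card = 4) (g : G)
    (hg : ∀ x ∈ Q, g • x = x) : g = 1 := by
  have hgQ : ∀ T ⊆ Q, g • T = T := by
    intro T hT
    ext x
    rw [Finset.mem_smul_finset]
    constructor
    · rintro ⟨y, hy, rfl⟩; rw [hg y (hT hy)]; exact hy
    · intro hx; exact ⟨x, hx, hg x (hT hx)⟩
  have hgB : g • B = B := by
    apply b.eq_of_four h hB (b.inv g B hB)
    rw [← hQ4]
    apply Finset.card_le_card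
    apply Finset.subset_inter hQ
    rw [← hgQ Q subset_rfl]
    exact Finset.smul_finset_subset_smul_finset hQ
  have hex : ∀ i, ∃ C : Finset X, i ∈ Q → C ∈ S ∧ B ∩ C = Q.erase i ∧ g • C = C := by
    intro i
    by_cases hi : i ∈ Q
    · have h3 : (Q.erase i).card = 3 := by rw [Finset.card_erase_of_mem hi, hQ4]
      obtain ⟨x, y, z, hxy, hxz, hyz, hT⟩ := Finset.card_eq_three.1 h3
      have hTB : Q.erase i ⊆ B := (Finset.erase_subset _ _).trans hQ
      obtain ⟨C, c1, c2, c3, c4⟩ := b.exists_other h hB hxy hxz hyz (hTB (by simp [hT]))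
        (hTB (by simp [hT])) (hTB (by simp [hT]))
      refine ⟨C, fun _ => ⟨c1, c3.trans hT.symm, ?_⟩⟩
      apply c4 _ (b.inv g C c1)
      · intro e
        apply c2
        rw [← hgB] at e
        exact smul_left_cancel g e
      · rw [← hT, ← hgQ _ (Finset.erase_subset i Q), Finset.smul_finset_subset_smul_finset_iff,
          hT, ← c3]
        exact Finset.inter_subset_right
    · exact ⟨∅, fun e => absurd e hi⟩
  choose C hC using hex
  have hmem : ∀ i ∈ Q, ∀ j ∈ Q, (j ∈ C i ↔ j ≠ i) := by
    intro i hi j hj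
    have := Finset.ext_iff.1 (hC i hi).2.1 j
    simp only [Finset.mem_inter, Finset.mem_erase, hQ hj, hj, true_and, and_true] at this
    exact this
  have hinj : ∀ i ∈ Q, ∀ j ∈ Q, C i = C j → i = j := by
    intro i hi j hj e
    by_contra hne
    have h1 := (hmem i hi j hj).2 (Ne.symm hne)
    rw [e, hmem j hj j hj] at h1
    exact h1 rfl
  have hBc : Bᶜ.card = 6 := b.six _ (b.compl B hB)
  have hsd : ∀ T : Finset X, (Bᶜ ∩ T).card + (B ∩ T).card = T.card := by
    intro T
    rw [← Finset.card_union_of_disjoint]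
    · congr 1; ext x; simp only [Finset.mem_union, Finset.mem_inter, Finset.mem_compl]; tauto
    · rw [Finset.disjoint_left]; intro x; simp only [Finset.mem_inter, Finset.mem_compl]; tauto
  have hfixc : ∀ x ∈ Bᶜ, g • x = x := by
    intro x hx
    obtain ⟨E, hE, F, hF, hEF, hxE, hxF⟩ := two_of_four (Q.image C) Bᶜ
      (by rw [Finset.card_image_of_injOn (fun i hi j hj => hinj i hi j hj), hQ4]) hBc
      (by
        intro E hE
        obtain ⟨i, hi, rfl⟩ := Finset.mem_image.1 hE
        have := hsd (C i)
        rw [(hC i hi).2.1, Finset.card_erase_of_mem hi, hQ4, b.six _ (hC i hi).1] at this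
        omega)
      (by
        intro E hE F hF hEF
        obtain ⟨i, hi, rfl⟩ := Finset.mem_image.1 hE
        obtain ⟨j, hj, rfl⟩ := Finset.mem_image.1 hF
        have hij : i ≠ j := fun e => hEF (e ▸ rfl)
        have h1 := hsd (C i ∩ C j)
        have h2 : B ∩ (C i ∩ C j) = (Q.erase i).erase j := by
          rw [Finset.inter_inter_distrib_left, (hC i hi).2.1, (hC j hj).2.1]
          ext x; simp only [Finset.mem_inter, Finset.mem_erase]; tauto
        have h3 : (B ∩ (C i ∩ C j)).card = 2 := by
          rw [h2, Finset.card_erase_of_mem (by simp [hij.symm, hj]),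
            Finset.card_erase_of_mem hi, hQ4]
        have h4 : (C i ∩ C j).card = 3 := by
          apply b.inter h (hC i hi).1 (hC j hj).1 hEF.symm
          intro e
          rw [e, Finset.inter_compl, Finset.inter_empty, Finset.card_empty] at h3
          omega
        omega) x hx
    have hfx : ∀ E ∈ Q.image C, g • E = E := by
      intro E hE
      obtain ⟨i, hi, rfl⟩ := Finset.mem_image.1 hE
      exact (hC i hi).2.2
    have hone : (Bᶜ ∩ (E ∩ F)).card = 1 := by
      obtain ⟨i, hi, rfl⟩ := Finset.mem_image.1 hE
      obtain ⟨j, hj, rfl⟩ := Finset.mem_image.1 hF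
      have hij : i ≠ j := fun e => hEF (e ▸ rfl)
      have h1 := hsd (C i ∩ C j)
      have h2 : B ∩ (C i ∩ C j) = (Q.erase i).erase j := by
        rw [Finset.inter_inter_distrib_left, (hC i hi).2.1, (hC j hj).2.1]
        ext x; simp only [Finset.mem_inter, Finset.mem_erase]; tauto
      have h3 : (B ∩ (C i ∩ C j)).card = 2 := by
        rw [h2, Finset.card_erase_of_mem (by simp [hij.symm, hj]),
          Finset.card_erase_of_mem hi, hQ4]
      have h4 : (C i ∩ C j).card = 3 := by
        apply b.inter h (hC i hi).1 (hC j hj).1 hEF.symm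
        intro e
        rw [e, Finset.inter_compl, Finset.inter_empty, Finset.card_empty] at h3
        omega
      omega
    have hgx : g • x ∈ Bᶜ ∩ (E ∩ F) := by
      simp only [Finset.mem_inter, Finset.mem_compl]
      refine ⟨?_, ?_, ?_⟩
      · rw [← hgB, Finset.smul_mem_smul_finset_iff]; simpa using hx
      · rw [← hfx E hE, Finset.smul_mem_smul_finset_iff]; exact hxE
      · rw [← hfx F hF, Finset.smul_mem_smul_finset_iff]; exact hxF
    exact Finset.card_le_one.1 hone.le _ hgx _ (by simp [hxE, hxF, Finset.mem_compl.1 hx])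
  by_contra hne
  obtain ⟨e, he⟩ := ne_one_exists (X := X) hne
  have heB : e ∈ B := by
    by_contra hc
    exact he (hfixc e (Finset.mem_compl.2 hc))
  have heQ : e ∉ Q := fun hc => he (hg e hc)
  have hfB : g • e ∈ B := by
    have := Finset.smul_mem_smul_finset (a := g) heB
    rwa [hgB] at this
  have hfQ : g • e ∉ Q := fun hc => he (smul_left_cancel g (hg _ hc))
  have hrest : ∀ x, x ≠ e → x ≠ g • e → g • x = x := by
    intro x hx1 hx2
    by_cases hxB : x ∈ B
    · have h2 : (B \ Q).card = 2 := by
        rw [Finset.card_sdiff_of_subset hQ, b.six B hB, hQ4]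
      have h3 : ({e, g • e} : Finset X) = B \ Q := by
        apply Finset.eq_of_subset_of_card_le
        · simp [Finset.insert_subset_iff, heB, heQ, hfB, hfQ]
        · rw [h2, Finset.card_pair (Ne.symm he)]
      by_cases hxQ : x ∈ Q
      · exact hg x hxQ
      · have : x ∈ ({e, g • e} : Finset X) := by rw [h3]; simp [hxB, hxQ]
        simp [hx1, hx2] at this
    · exact hfixc x (Finset.mem_compl.2 hxB)
  obtain ⟨-, c1, c2, -⟩ := b.counts h
  obtain ⟨D, hD, heD, hfD⟩ : ∃ D ∈ S, e ∈ D ∧ g • e ∉ D := by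
    by_contra! hc
    have : rr S {e} ≤ rr S {e, g • e} := by
      apply Finset.card_le_card
      intro D hD
      simp only [Finset.mem_filter, Finset.singleton_subset_iff, Finset.insert_subset_iff] at hD ⊢
      exact ⟨hD.1, hD.2, hc D hD.1 hD.2⟩
    rw [c1, c2 _ _ (Ne.symm he)] at this
    omega
  have hgD : g • D = D := by
    apply b.eq_of_four h hD (b.inv g D hD)
    have : D.erase e ⊆ D ∩ g • D := by
      intro x hx
      rw [Finset.mem_erase] at hx
      rw [Finset.mem_inter]
      refine ⟨hx.2, ?_⟩
      rw [← hrest x hx.1 (fun e => hfD (e ▸ hx.2)), Finset.smul_mem_smul_finset_iff]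
      exact hx.2
    have := Finset.card_le_card this
    rw [Finset.card_erase_of_mem heD, b.six D hD] at this
    omega
  apply hfD
  rw [← hgD, Finset.smul_mem_smul_finset_iff]
  exact heD

end fix4
end M11

namespace M11
open MulAction
open scoped Pointwise

section order
variable {G X : Type*} [Group G] [Finite G] [MulAction G X] [FaithfulSMul G X]
  [Fintype X] [DecidableEq X] (h : Elts G X)
include h

lemma Elts.conj_fix {a b c : X} (hab : a ≠ b) (hc : c ≠ a ∧ c ≠ b) (θ : G)
    (hθ : 3 ≤ (Finset.univ.filter (fun x : X => θ • x = x)).card) :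
    ∃ k : G, (k * θ * k⁻¹) ∈ stabilizer G a ⊓ stabilizer G b ⊓ stabilizer G c := by
  obtain ⟨x, y, z, hx, hy, hz, hxy, hxz, hyz⟩ := Finset.two_lt_card_iff.1 hθ
  obtain ⟨k, rfl, rfl, rfl⟩ := h.trans3 hxy ⟨hxz.symm, hyz.symm⟩ hab hc
  simp only [Finset.mem_filter, Finset.mem_univ, true_and] at hx hy hz
  refine ⟨k, ⟨?_, ?_⟩, ?_⟩ <;>
    simp [mul_smul, hx, hy, hz]

lemma Elts.six_dvd {a b c : X} (hab : a ≠ b) (hc : c ≠ a ∧ c ≠ b) :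
    6 ∣ Nat.card (stabilizer G a ⊓ stabilizer G b ⊓ stabilizer G c : Subgroup G) := by
  have key : ∀ l : ℕ, l.Prime → ∀ θ : G, θ ≠ 1 → θ ^ l = 1 →
      3 ≤ (Finset.univ.filter (fun x : X => θ • x = x)).card →
      l ∣ Nat.card (stabilizer G a ⊓ stabilizer G b ⊓ stabilizer G c : Subgroup G) := by
    intro l hl θ h1 h2 h3
    have : Fact l.Prime := ⟨hl⟩
    obtain ⟨k, hk⟩ := h.conj_fix hab hc θ h3
    rw [← orderOf_eq_prime (x := k * θ * k⁻¹) (p := l) (by rw [conj_pow, h2]; group) (by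
      intro e; apply h1; simpa [mul_inv_eq_one] using e)]
    exact Subgroup.orderOf_dvd_natCard _ hk
  apply Nat.Coprime.mul_dvd_of_dvd_of_dvd (m := 2) (n := 3) (by norm_num)
  · obtain ⟨κ, h1, h2, h3, h4⟩ := h.k
    exact key 2 Nat.prime_two (κ ^ 2) h2 (by rw [← pow_mul]; exact h1) h4
  · obtain ⟨θ, h1, h2⟩ := h.th
    refine key 3 Nat.prime_three θ ?_ h1 h2.ge
    rintro rfl
    simp [h.card] at h2

/-- cardinality of a subgroup that is sharply transitive on ordered triples -/
lemma Elts.card_of_trans (N : Subgroup G) {p q r : X} (hpq : p ≠ q) (hr : r ≠ p ∧ r ≠ q)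
    (t1 : ∀ x, ∃ n ∈ N, n • p = x)
    (t2 : ∀ x, x ≠ p → ∃ n ∈ N ⊓ stabilizer G p, n • q = x)
    (t3 : ∀ x, x ≠ p → x ≠ q → ∃ n ∈ N ⊓ stabilizer G p ⊓ stabilizer G q, n • r = x) :
    Nat.card N = 12 * Nat.card (N ⊓ stabilizer G p : Subgroup G) ∧
    Nat.card (N ⊓ stabilizer G p : Subgroup G) =
      11 * Nat.card (N ⊓ stabilizer G p ⊓ stabilizer G q : Subgroup G) ∧
    Nat.card (N ⊓ stabilizer G p ⊓ stabilizer G q : Subgroup G) =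
      10 * Nat.card (N ⊓ stabilizer G p ⊓ stabilizer G q ⊓ stabilizer G r : Subgroup G) := by
  refine ⟨?_, ?_, ?_⟩
  · rw [orb_os N p]
    congr 1
    rw [← h.card, Finset.card_eq_iff_eq_univ]
    ext x
    simpa [mem_orb] using t1 x
  · rw [orb_os (N ⊓ stabilizer G p) q]
    congr 1
    have : orb (N ⊓ stabilizer G p) q = Finset.univ.erase p := by
      ext x
      simp only [mem_orb, Finset.mem_erase, Finset.mem_univ, and_true]
      refine ⟨?_, t2 x⟩
      rintro ⟨k, hk, rfl⟩ e
      have : k • p = p := hk.2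
      exact hpq (smul_left_cancel k (e.trans this.symm)).symm
    rw [this, Finset.card_erase_of_mem (Finset.mem_univ _), Finset.card_univ, h.card]
  · rw [orb_os (N ⊓ stabilizer G p ⊓ stabilizer G q) r]
    congr 1
    have : orb (N ⊓ stabilizer G p ⊓ stabilizer G q) r = (Finset.univ.erase p).erase q := by
      ext x
      simp only [mem_orb, Finset.mem_erase, Finset.mem_univ, and_true]
      refine ⟨?_, fun hx => t3 x hx.2 hx.1⟩
      rintro ⟨k, hk, rfl⟩
      have h1 : k • q = q := hk.2
      have h2 : k • p = p := hk.1.2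
      exact ⟨fun e => hr.2 (smul_left_cancel k (e.trans h1.symm)),
        fun e => hr.1 (smul_left_cancel k (e.trans h2.symm))⟩
    rw [this, Finset.card_erase_of_mem (by simp [hpq.symm]),
        Finset.card_erase_of_mem (Finset.mem_univ _), Finset.card_univ, h.card]

lemma Elts.card_top {p q r : X} (hpq : p ≠ q) (hr : r ≠ p ∧ r ≠ q) :
    Nat.card G = 1320 * Nat.card (stabilizer G p ⊓ stabilizer G q ⊓ stabilizer G r : Subgroup G)
    ∧ Nat.card (stabilizer G p ⊓ stabilizer G q : Subgroup G) =
      10 * Nat.card (stabilizer G p ⊓ stabilizer G q ⊓ stabilizer G r : Subgroup G) := by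
  obtain ⟨h1, h2, h3⟩ := h.card_of_trans (⊤ : Subgroup G) hpq hr
    (fun x => by
      obtain ⟨g, hg⟩ := h.trans1 p x
      exact ⟨g, Subgroup.mem_top _, hg⟩)
    (fun x hx => by
      obtain ⟨g, hg1, hg2⟩ := h.trans2 hpq hx.symm
      exact ⟨g, ⟨Subgroup.mem_top _, hg1⟩, hg2⟩)
    (fun x hx hx' => by
      obtain ⟨g, hg1, hg2, hg3⟩ := h.trans3 hpq hr hpq ⟨hx, hx'⟩
      exact ⟨g, ⟨⟨Subgroup.mem_top _, hg1⟩, hg2⟩, hg3⟩)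
  simp only [top_inf_eq] at h1 h2 h3
  rw [Subgroup.card_top] at h1
  refine ⟨?_, h3⟩
  rw [h1, h2, h3]; ring

lemma Elts.card_stab3 {S : Finset (Finset X)} (b : Blocks G S) {p q r : X} (hpq : p ≠ q)
    (hr : r ≠ p ∧ r ≠ q) :
    Nat.card (stabilizer G p ⊓ stabilizer G q ⊓ stabilizer G r : Subgroup G) = 6 := by
  apply le_antisymm _ (Nat.le_of_dvd Nat.card_pos (h.six_dvd hpq hr))
  obtain ⟨-, -, -, c3⟩ := b.counts h
  have h2 := c3 p q r hpq hr.1.symm hr.2.symm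
  unfold rr at h2
  obtain ⟨B, C, hBC, hS⟩ := Finset.card_eq_two.1 h2
  have hm : ∀ D, (D ∈ S ∧ {p, q, r} ⊆ D) ↔ (D = B ∨ D = C) := fun D => by
    simpa using Finset.ext_iff.1 hS D
  have hT : ({p, q, r} : Finset X).card = 3 :=
    Finset.card_eq_three.2 ⟨p, q, r, hpq, hr.1.symm, hr.2.symm, rfl⟩
  have hB := (hm B).2 (Or.inl rfl)
  have hC := (hm C).2 (Or.inr rfl)
  have hcB : (B \ {p, q, r}).card = 3 := by
    rw [Finset.card_sdiff_of_subset hB.2, b.six B hB.1, hT]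
  have hcC : (C \ {p, q, r}).card = 3 := by
    rw [Finset.card_sdiff_of_subset hC.2, b.six C hC.1, hT]
  obtain ⟨d, hd⟩ : (B \ {p, q, r}).Nonempty := by
    rw [← Finset.card_pos]; omega
  rw [Finset.mem_sdiff] at hd
  let L : Subgroup G := stabilizer G p ⊓ stabilizer G q ⊓ stabilizer G r
  have hLfix : ∀ g ∈ L, ∀ x ∈ ({p, q, r} : Finset X), g • x = x := by
    intro g hg x hx
    simp only [Finset.mem_insert, Finset.mem_singleton] at hx
    rcases hx with rfl | rfl | rfl
    exacts [hg.1.1, hg.1.2, hg.2]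
  have hos := orb_os L d
  have hbot : L ⊓ stabilizer G d = ⊥ := by
    rw [eq_bot_iff]
    intro g hg
    rw [Subgroup.mem_bot]
    apply b.fix4 h hB.1 (Q := insert d {p, q, r})
    · exact Finset.insert_subset hd.1 hB.2
    · rw [Finset.card_insert_of_notMem hd.2, hT]
    · intro x hx
      rw [Finset.mem_insert] at hx
      rcases hx with rfl | hx
      · exact hg.2
      · exact hLfix g hg.1 x hx
  have hsub : orb L d ⊆ (B \ {p, q, r}) ∪ (C \ {p, q, r}) := by
    intro x hx
    obtain ⟨g, hg, rfl⟩ := mem_orb.1 hx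
    have hgT : ({p, q, r} : Finset X) ⊆ g • B := by
      intro x hx
      rw [← hLfix g hg x hx, Finset.smul_mem_smul_finset_iff]
      exact hB.2 hx
    have hgd : g • d ∉ ({p, q, r} : Finset X) := by
      intro e
      have := hLfix g hg _ e
      have := smul_left_cancel g this
      rw [this] at e
      exact hd.2 e
    have hgd2 : g • d ∈ g • B := Finset.smul_mem_smul_finset hd.1
    rw [Finset.mem_union, Finset.mem_sdiff, Finset.mem_sdiff]
    rcases (hm (g • B)).1 ⟨b.inv g B hB.1, hgT⟩ with e | e
    · left; rw [e] at hgd2; exact ⟨hgd2, hgd⟩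
    · right; rw [e] at hgd2; exact ⟨hgd2, hgd⟩
  have := (Finset.card_le_card hsub).trans (Finset.card_union_le _ _)
  change Nat.card L ≤ 6
  rw [hos, hbot, Subgroup.card_bot]
  omega

lemma Elts.exists3 : ∃ p q r : X, p ≠ q ∧ r ≠ p ∧ r ≠ q := by
  obtain ⟨p, q, r, hpq, hpr, hqr⟩ : ∃ p q r : X, p ≠ q ∧ p ≠ r ∧ q ≠ r := by
    rw [← Fintype.two_lt_card_iff, h.card]; norm_num
  exact ⟨p, q, r, hpq, hpr.symm, hqr.symm⟩

lemma Elts.card_eq {S : Finset (Finset X)} (b : Blocks G S) : Nat.card G = 7920 := by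
  obtain ⟨p, q, r, hpq, hr⟩ := h.exists3
  rw [(h.card_top hpq hr).1, h.card_stab3 b hpq hr]

/-- Lemma V -/
lemma Elts.normalized_trans {p q : X} (hpq : p ≠ q) (L : Subgroup G)
    (hL : L ≤ stabilizer G p ⊓ stabilizer G q) (hL1 : L ≠ ⊥)
    (hn : ∀ g ∈ stabilizer G p ⊓ stabilizer G q, ∀ x ∈ L, g * x * g⁻¹ ∈ L) (r : X)
    (hr : r ≠ p ∧ r ≠ q) : orb L r = (Finset.univ.erase p).erase q := by
  have hout : ∀ x, (x ≠ p ∧ x ≠ q) → orb L x ⊆ (Finset.univ.erase p).erase q := by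
    intro x hx y hy
    obtain ⟨k, hk, rfl⟩ := mem_orb.1 hy
    have h1 : k • p = p := (hL hk).1
    have h2 : k • q = q := (hL hk).2
    simp only [Finset.mem_erase, Finset.mem_univ, and_true]
    exact ⟨fun e => hx.2 (smul_left_cancel k (e.trans h2.symm)),
        fun e => hx.1 (smul_left_cancel k (e.trans h1.symm))⟩
  have hsm : ∀ g ∈ stabilizer G p ⊓ stabilizer G q, ∀ x : X, (orb L (g • x)) = g • orb L x := by
    intro g hg x
    ext y
    rw [Finset.mem_smul_finset]
    simp only [mem_orb]
    constructor
    · rintro ⟨k, hk, rfl⟩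
      refine ⟨_, ⟨g⁻¹ * k * g⁻¹⁻¹, hn _ (inv_mem hg) k hk, rfl⟩, ?_⟩
      simp [mul_smul]
    · rintro ⟨_, ⟨k, hk, rfl⟩, rfl⟩
      exact ⟨g * k * g⁻¹, hn g hg k hk, by simp [mul_smul]⟩
  have hcardeq : ∀ x, (x ≠ p ∧ x ≠ q) → (orb L x).card = (orb L r).card := by
    intro x hx
    obtain ⟨g, hg1, hg2, rfl⟩ := h.trans3' hpq hr hx
    rw [hsm g ⟨hg1, hg2⟩, Finset.card_smul_finset]
  have hc : (((Finset.univ : Finset X).erase p).erase q).card = 10 := by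
    rw [Finset.card_erase_of_mem (by simp [hpq.symm]),
        Finset.card_erase_of_mem (Finset.mem_univ _), Finset.card_univ, h.card]
  have horbeq : ∀ x y : X, y ∈ orb L x → orb L y = orb L x := by
    intro x y hy
    obtain ⟨k, hk, rfl⟩ := mem_orb.1 hy
    ext z
    simp only [mem_orb]
    constructor
    · rintro ⟨m, hm, rfl⟩; exact ⟨m * k, L.mul_mem hm hk, mul_smul _ _ _⟩
    · rintro ⟨m, hm, rfl⟩
      exact ⟨m * k⁻¹, L.mul_mem hm (L.inv_mem hk), by simp [mul_smul]⟩
  have hdvd : (orb L r).card ∣ 10 := by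
    rw [← hc, Finset.card_eq_sum_card_image (orb L) ((Finset.univ.erase p).erase q)]
    apply Finset.dvd_sum
    intro O hO
    obtain ⟨x, hx, rfl⟩ := Finset.mem_image.1 hO
    simp only [Finset.mem_erase, Finset.mem_univ, and_true] at hx
    rw [← hcardeq x hx.symm]
    apply dvd_of_eq
    congr 1
    ext y
    rw [Finset.mem_filter]
    constructor
    · intro hy; exact ⟨hout x hx.symm hy, horbeq _ _ hy⟩
    · rintro ⟨-, hy⟩; rw [← hy]; exact self_mem_orb _ _
  have hne1 : (orb L r).card ≠ 1 := by
    intro h1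
    obtain ⟨⟨k, hk⟩, hk1⟩ := Subgroup.ne_bot_iff_exists_ne_one.1 hL1
    have hk1 : k ≠ 1 := fun e => hk1 (Subtype.ext e)
    obtain ⟨x, hx⟩ := ne_one_exists (X := X) hk1
    have hxp : x ≠ p := by rintro rfl; exact hx (hL hk).1
    have hxq : x ≠ q := by rintro rfl; exact hx (hL hk).2
    rw [← hcardeq x ⟨hxp, hxq⟩] at h1
    exact hx (Finset.card_le_one.1 h1.le _ (mem_orb.2 ⟨k, hk, rfl⟩) _ (self_mem_orb _ _))
  obtain ⟨θ, c, ht, hcp, hcq, hθ⟩ := h.theta2 hpq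
  have : Fact (Nat.Prime 3) := ⟨by norm_num⟩
  have hθm : θ ∈ stabilizer G p ⊓ stabilizer G q := ⟨by simp [hθ], by simp [hθ]⟩
  have h5 := card_modEq θ 3 ht (orb L c) (by
    intro x hx
    have h1 := hsm θ hθm c
    rw [(hθ c).2 (by simp)] at h1
    rw [h1, Finset.smul_mem_smul_finset_iff]
    exact hx)
  have h6 : (orb L c).filter (fun x => θ • x = x) = {c} := by
    ext x
    simp only [Finset.mem_filter, hθ, Finset.mem_singleton]
    constructor
    · rintro ⟨hx, rfl | rfl | rfl⟩
      · have := hout c ⟨hcp, hcq⟩ hx; simp at this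
      · have := hout c ⟨hcp, hcq⟩ hx; simp at this
      · rfl
    · rintro rfl; exact ⟨self_mem_orb _ _, by simp⟩
  rw [h6, Finset.card_singleton, hcardeq c ⟨hcp, hcq⟩] at h5
  apply Finset.eq_of_subset_of_card_le (hout r hr)
  rw [hc]
  have h7 := Nat.le_of_dvd (by norm_num) hdvd
  unfold Nat.ModEq at h5
  interval_cases (orb L r).card <;> omega

end order
end M11

namespace M11
open MulAction
open scoped Pointwise

section simple
variable {G X : Type*} [Group G] [Finite G] [MulAction G X] [FaithfulSMul G X]
  [Fintype X] [DecidableEq X] (h : Elts G X) (N : Subgroup G) [hN : N.Normal]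
include h

lemma Elts.n_trans1 (hN1 : N ≠ ⊥) (p x : X) : ∃ n ∈ N, n • p = x := by
  by_cases hpx : p = x
  · exact ⟨1, N.one_mem, by rw [one_smul, hpx]⟩
  obtain ⟨⟨k, hk⟩, hk1⟩ := Subgroup.ne_bot_iff_exists_ne_one.1 hN1
  have hk1 : k ≠ 1 := fun e => hk1 (Subtype.ext e)
  obtain ⟨u, hu⟩ := ne_one_exists (X := X) hk1
  obtain ⟨g, rfl, rfl⟩ := h.trans2 hu.symm hpx
  exact ⟨g * k * g⁻¹, hN.conj_mem k hk g, by simp [mul_smul]⟩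

lemma Elts.n_stab1 (hN1 : N ≠ ⊥) (p : X) : N ⊓ stabilizer G p ≠ ⊥ := by
  intro hb
  have hc := orb_os N p
  have h12 : orb N p = Finset.univ := by
    ext x; simpa [mem_orb] using h.n_trans1 N hN1 p x
  rw [hb, Subgroup.card_bot, h12, Finset.card_univ, h.card] at hc
  have : Fact (Nat.Prime 2) := ⟨by norm_num⟩
  have : Fact (Nat.Prime 3) := ⟨by norm_num⟩
  obtain ⟨⟨a, ha⟩, ha2⟩ := exists_prime_orderOf_dvd_card' (G := N) 2 (by rw [hc]; norm_num)
  obtain ⟨⟨c, hc'⟩, hc3⟩ := exists_prime_orderOf_dvd_card' (G := N) 3 (by rw [hc]; norm_num)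
  rw [Subgroup.orderOf_mk] at ha2 hc3
  have hbot : ∀ n ∈ N, n • p = p → n = 1 := by
    intro n hn hnp
    have : n ∈ N ⊓ stabilizer G p := ⟨hn, hnp⟩
    rwa [hb, Subgroup.mem_bot] at this
  have hap : p ≠ a • p := by
    intro e
    have := hbot a ha e.symm
    rw [this, orderOf_one] at ha2; omega
  have hcp : p ≠ c • p := by
    intro e
    have := hbot c hc' e.symm
    rw [this, orderOf_one] at hc3; omega
  obtain ⟨g, hg1, hg2⟩ := h.trans2 hap hcp
  have h1 : c⁻¹ * (g * a * g⁻¹) = 1 := by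
    apply hbot _ (N.mul_mem (N.inv_mem hc') (hN.conj_mem a ha g))
    have : g⁻¹ • p = p := by rw [inv_smul_eq_iff, hg1]
    rw [mul_smul, mul_smul, mul_smul, this, hg2, inv_smul_smul]
  have h2 : c = g * a * g⁻¹ := by rwa [inv_mul_eq_one] at h1
  have h3 : c ^ 2 = 1 := by
    rw [h2, conj_pow, ← ha2, pow_orderOf_eq_one]; group
  have := orderOf_dvd_of_pow_eq_one h3
  rw [hc3] at this
  omega

lemma Elts.n_trans2 (hN1 : N ≠ ⊥) {p q : X} (hpq : p ≠ q) (x : X) (hx : x ≠ p) :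
    ∃ n ∈ N ⊓ stabilizer G p, n • q = x := by
  by_cases hqx : q = x
  · exact ⟨1, one_mem _, by rw [one_smul, hqx]⟩
  obtain ⟨⟨k, hk⟩, hk1⟩ := Subgroup.ne_bot_iff_exists_ne_one.1 (h.n_stab1 N hN1 p)
  have hk1 : k ≠ 1 := fun e => hk1 (Subtype.ext e)
  obtain ⟨u, hu⟩ := ne_one_exists (X := X) hk1
  have hkp : k • p = p := hk.2
  have hup : u ≠ p := by rintro rfl; exact hu hkp
  have hup2 : k • u ≠ p := fun e => hup (smul_left_cancel k (e.trans hkp.symm))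
  obtain ⟨g, hg1, rfl, rfl⟩ := h.trans3 hup.symm ⟨hup2, hu⟩ hpq ⟨hx, Ne.symm hqx⟩
  refine ⟨g * k * g⁻¹, ⟨hN.conj_mem k hk.1 g, ?_⟩, by simp [mul_smul]⟩
  have : g⁻¹ • p = p := by rw [inv_smul_eq_iff, hg1]
  change (g * k * g⁻¹) • p = p
  rw [mul_smul, mul_smul, this, hkp, hg1]

lemma Elts.n_stab2 (hN1 : N ≠ ⊥) {p q : X} (hpq : p ≠ q) :
    N ⊓ stabilizer G p ⊓ stabilizer G q ≠ ⊥ := by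
  intro hb
  have hbot : ∀ x, x ≠ p → ∀ n ∈ N, n • p = p → n • x = x → n = 1 := by
    intro x hx n hn hnp hnx
    obtain ⟨g, hg1, hg2⟩ := h.trans2 hx.symm hpq
    have hgp : g⁻¹ • p = p := by rw [inv_smul_eq_iff, hg1]
    have hgq : g⁻¹ • q = x := by rw [inv_smul_eq_iff, hg2]
    have : g * n * g⁻¹ ∈ N ⊓ stabilizer G p ⊓ stabilizer G q := by
      refine ⟨⟨hN.conj_mem n hn g, ?_⟩, ?_⟩
      · change (g * n * g⁻¹) • p = p
        rw [mul_smul, mul_smul, hgp, hnp, hg1]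
      · change (g * n * g⁻¹) • q = q
        rw [mul_smul, mul_smul, hgq, hnx, hg2]
    rw [hb, Subgroup.mem_bot] at this
    simpa [mul_inv_eq_one] using this
  obtain ⟨θ, r, ht, hrp, hrq, hθ⟩ := h.theta2 hpq
  obtain ⟨n, hn, hnq⟩ := h.n_trans2 N hN1 hpq r hrp
  have hnp : n • p = p := hn.2
  have tp : θ • p = p := (hθ p).2 (by simp)
  have tq : θ • q = q := (hθ q).2 (by simp)
  have tr : θ • r = r := (hθ r).2 (by simp)
  have tp' : θ⁻¹ • p = p := by rw [inv_smul_eq_iff, tp]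
  have tq' : θ⁻¹ • q = q := by rw [inv_smul_eq_iff, tq]
  have hcomm : n⁻¹ * (θ * n * θ⁻¹) = 1 := by
    apply hbot q hpq.symm _ (N.mul_mem (N.inv_mem hn.1) (hN.conj_mem n hn.1 θ))
    · rw [mul_smul, mul_smul, mul_smul, tp', hnp, tp, inv_smul_eq_iff, hnp]
    · rw [mul_smul, mul_smul, mul_smul, tq', hnq, tr, inv_smul_eq_iff, hnq]
  have hcomm' : θ * n = n * θ := by
    rw [inv_mul_eq_one] at hcomm
    nth_rewrite 2 [hcomm]; group
  have hnr : n • r = p ∨ n • r = q ∨ n • r = r := by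
    rw [← hθ, ← mul_smul, hcomm', mul_smul, tr]
  have hnr' : n • r = q := by
    rcases hnr with e | e | e
    · exact absurd (smul_left_cancel n (e.trans hnp.symm)) hrp
    · exact e
    · exact absurd (smul_left_cancel n (e.trans hnq.symm)) hrq
  have hn2 : n ^ 2 = 1 := by
    apply hbot q hpq.symm _ (N.pow_mem hn.1 2)
    · rw [sq, mul_smul, hnp, hnp]
    · rw [sq, mul_smul, hnq, hnr']
  have : Fact (Nat.Prime 2) := ⟨by norm_num⟩
  have hm := card_modEq n 2 hn2 (Finset.univ : Finset X) (fun _ _ => Finset.mem_univ _)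
  have hf : (Finset.univ.filter (fun x : X => n • x = x)) = {p} := by
    ext x
    simp only [Finset.mem_filter, Finset.mem_univ, true_and, Finset.mem_singleton]
    constructor
    · intro hx
      by_contra hxp
      have := hbot x hxp n hn.1 hnp hx
      rw [this, one_smul] at hnq
      exact hrq hnq.symm
    · rintro rfl; exact hnp
  rw [hf, Finset.card_univ, h.card, Finset.card_singleton] at hm
  unfold Nat.ModEq at hm
  omega

lemma Elts.n_conj2 {p q : X} (g : G) (hg : g ∈ stabilizer G p ⊓ stabilizer G q) (x : G)
    (hx : x ∈ N ⊓ stabilizer G p ⊓ stabilizer G q) :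
    g * x * g⁻¹ ∈ N ⊓ stabilizer G p ⊓ stabilizer G q := by
  refine ⟨⟨hN.conj_mem x hx.1.1 g, ?_⟩, ?_⟩
  · exact (stabilizer G p).mul_mem ((stabilizer G p).mul_mem hg.1 hx.1.2) ((stabilizer G p).inv_mem hg.1)
  · exact (stabilizer G q).mul_mem ((stabilizer G q).mul_mem hg.2 hx.2) ((stabilizer G q).inv_mem hg.2)

lemma Elts.n_card (hN1 : N ≠ ⊥) {p q r : X} (hpq : p ≠ q) (hr : r ≠ p ∧ r ≠ q) :
    Nat.card N = 1320 *
      Nat.card (N ⊓ stabilizer G p ⊓ stabilizer G q ⊓ stabilizer G r : Subgroup G) ∧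
    Nat.card (N ⊓ stabilizer G p ⊓ stabilizer G q : Subgroup G) =
      10 * Nat.card (N ⊓ stabilizer G p ⊓ stabilizer G q ⊓ stabilizer G r : Subgroup G) := by
  obtain ⟨h1, h2, h3⟩ := h.card_of_trans N hpq hr (h.n_trans1 N hN1 p)
    (h.n_trans2 N hN1 hpq)
    (fun x hx hx' => by
      have := h.normalized_trans hpq (N ⊓ stabilizer G p ⊓ stabilizer G q)
        (by rw [inf_assoc]; exact inf_le_right) (h.n_stab2 N hN1 hpq)
        (fun g hg x hx => h.n_conj2 N g hg x hx) r hr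
      rw [← mem_orb, this]; simp [hx, hx'])
  refine ⟨?_, h3⟩
  rw [h1, h2, h3]; ring

lemma Elts.n_big (hN1 : N ≠ ⊥) {p q : X} (hpq : p ≠ q) :
    25 ≤ Nat.card (N ⊓ stabilizer G p ⊓ stabilizer G q : Subgroup G) := by
  set L : Subgroup G := N ⊓ stabilizer G p ⊓ stabilizer G q with hL
  have : Fact (Nat.Prime 5) := ⟨by norm_num⟩
  obtain ⟨θ, r, -, hrp, hrq, -⟩ := h.theta2 hpq
  obtain ⟨-, h2⟩ := h.n_card N hN1 hpq ⟨hrp, hrq⟩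
  obtain ⟨⟨a, ha⟩, ha5⟩ := exists_prime_orderOf_dvd_card' (G := L) 5 (by
    rw [hL, h2]; exact Dvd.dvd.mul_right (by norm_num) _)
  rw [Subgroup.orderOf_mk] at ha5
  by_contra! hlt
  have hA : Nat.card (Subgroup.zpowers a) = 5 := by rw [Nat.card_zpowers, ha5]
  have hAL : Subgroup.zpowers a ≤ L := by rwa [Subgroup.zpowers_le]
  have hnorm : ∀ g ∈ stabilizer G p ⊓ stabilizer G q, g * a * g⁻¹ ∈ Subgroup.zpowers a := by
    intro g hg
    by_contra hna
    have hgL : g * a * g⁻¹ ∈ L := h.n_conj2 N g hg a ha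
    have ho : orderOf (g * a * g⁻¹) = 5 := by
      apply orderOf_eq_prime
      · rw [conj_pow, ← ha5, pow_orderOf_eq_one]; group
      · intro e; apply hna; rw [e]; exact one_mem _
    have hB : Nat.card (Subgroup.zpowers (g * a * g⁻¹)) = 5 := by rw [Nat.card_zpowers, ho]
    have hdis : Disjoint (Subgroup.zpowers a) (Subgroup.zpowers (g * a * g⁻¹)) := by
      rw [disjoint_iff]
      have hd : Nat.card (Subgroup.zpowers a ⊓ Subgroup.zpowers (g * a * g⁻¹) : Subgroup G) ∣ 5 := by
        rw [← hB]; exact Subgroup.card_dvd_of_le inf_le_right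
      rcases (Nat.dvd_prime (by norm_num)).1 hd with e | e
      · exact Subgroup.card_eq_one.1 e
      · exfalso
        apply hna
        have : Subgroup.zpowers a ⊓ Subgroup.zpowers (g * a * g⁻¹)
            = Subgroup.zpowers (g * a * g⁻¹) := by
          apply Subgroup.eq_of_le_of_card_ge inf_le_right
          rw [e, hB]
        have h2 : Subgroup.zpowers (g * a * g⁻¹) ≤ Subgroup.zpowers a := by
          rw [← this]; exact inf_le_left
        exact h2 (Subgroup.mem_zpowers _)
    have hinj := Subgroup.mul_injective_of_disjoint hdis
    have hBL : Subgroup.zpowers (g * a * g⁻¹) ≤ L := by rwa [Subgroup.zpowers_le]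
    have := Nat.card_le_card_of_injective
      (fun x : Subgroup.zpowers a × Subgroup.zpowers (g * a * g⁻¹) =>
        (⟨x.1.1 * x.2.1, L.mul_mem (hAL x.1.2) (hBL x.2.2)⟩ : L))
      (fun x y e => hinj (congrArg Subtype.val e))
    rw [Nat.card_prod, hA, hB] at this
    omega
  have h10 := h.normalized_trans hpq (Subgroup.zpowers a)
    (hAL.trans (by rw [hL, inf_assoc]; exact inf_le_right))
    (by intro e; rw [e, Subgroup.card_bot] at hA; omega)
    (by
      rintro g hg x ⟨k, rfl⟩
      have := Subgroup.zpow_mem _ (hnorm g hg) k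
      rwa [conj_zpow] at this) r ⟨hrp, hrq⟩
  have hos := orb_os (Subgroup.zpowers a) r
  have hc : (((Finset.univ : Finset X).erase p).erase q).card = 10 := by
    rw [Finset.card_erase_of_mem (by simp [hpq.symm]),
        Finset.card_erase_of_mem (Finset.mem_univ _), Finset.card_univ, h.card]
  rw [h10, hA, hc] at hos
  omega

omit hN in
theorem core {S : Finset (Finset X)} (b : Blocks G S) :
    Nat.card G = 7920 ∧ IsSimpleGroup G := by
  have hG := h.card_eq b
  refine ⟨hG, ?_⟩
  have hnt : Nontrivial G := by
    rw [← Finite.one_lt_card_iff_nontrivial, hG]; norm_num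
  refine ⟨fun N hN => ?_⟩
  by_cases hN1 : N = ⊥
  · exact Or.inl hN1
  right
  obtain ⟨κ, k1, k2, -, k4⟩ := h.k
  obtain ⟨p, q, r, hp, hq, hr, hpq, hpr, hqr⟩ := Finset.two_lt_card_iff.1 k4
  simp only [Finset.mem_filter, Finset.mem_univ, true_and] at hp hq hr
  obtain ⟨c1, c2⟩ := h.n_card N hN1 hpq ⟨hpr.symm, hqr.symm⟩
  have hbig := h.n_big N hN1 hpq
  have h6 := h.card_stab3 b hpq ⟨hpr.symm, hqr.symm⟩
  have hdvd : Nat.card (N ⊓ stabilizer G p ⊓ stabilizer G q ⊓ stabilizer G r : Subgroup G) ∣ 6 := by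
    rw [← h6]
    apply Subgroup.card_dvd_of_le
    rw [inf_assoc, inf_assoc, inf_assoc]
    exact inf_le_right
  have hle := Nat.le_of_dvd (by norm_num) hdvd
  have hcases : Nat.card (N ⊓ stabilizer G p ⊓ stabilizer G q ⊓ stabilizer G r : Subgroup G) = 3 ∨
      Nat.card (N ⊓ stabilizer G p ⊓ stabilizer G q ⊓ stabilizer G r : Subgroup G) = 6 := by
    have : 3 ≤ Nat.card (N ⊓ stabilizer G p ⊓ stabilizer G q ⊓ stabilizer G r : Subgroup G) := by
      omega
    revert hdvd hle this
    generalize Nat.card (N ⊓ stabilizer G p ⊓ stabilizer G q ⊓ stabilizer G r : Subgroup G) = j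
    intro h1 h2 h3
    interval_cases j <;> omega
  rcases hcases with e | e
  · exfalso
    have hidx : N.index = 2 := by
      have := N.card_mul_index
      rw [c1, e, hG] at this
      omega
    have hk : κ ^ 2 ∈ N := Subgroup.sq_mem_of_index_two hidx κ
    have hm : κ ^ 2 ∈ N ⊓ stabilizer G p ⊓ stabilizer G q ⊓ stabilizer G r :=
      ⟨⟨⟨hk, hp⟩, hq⟩, hr⟩
    have ho : orderOf (κ ^ 2) = 2 := by
      have : Fact (Nat.Prime 2) := ⟨by norm_num⟩
      apply orderOf_eq_prime _ k2
      rw [← pow_mul]; exact k1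
    have := Subgroup.orderOf_dvd_natCard _ hm
    rw [ho, e] at this
    omega
  · rw [← Subgroup.card_eq_iff_eq_top, c1, e, hG]

end simple
end M11

namespace M11

section cert
variable {E : Type*} [CommRing E]

def ca (w : E) : E :=
    -16896 + 97856 * w + 2016960 * w ^ 2 + 6891456 * w ^ 3 - 3163952 * w ^ 4 - 29315880 * w ^ 5
    + 32562552 * w ^ 6 + 21491294 * w ^ 7 - 5142984 * w ^ 8 - 1094082 * w ^ 9 + 58564 * w ^ 10

def cb (w : E) : E :=
    384 - 960 * w + 6912 * w ^ 2 + 15504 * w ^ 3 - 269736 * w ^ 4 - 268400 * w ^ 5 + 203874 * w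
    ^ 6 + 47916 * w ^ 7 - 9922 * w ^ 8

def ch (w : E) : E :=
    w ^ 3 + 8 * w + 2

def cU (w : E) : E :=
    263538 * w * (w ^ 3 + 8 * w + 2) ^ 2

def cA5 (w : E) : E :=
    5270760 * w + 42166080 * w ^ 2 + 84332160 * w ^ 3 + 5270760 * w ^ 4 + 21083040 * w ^ 5 +
    1317690 * w ^ 7

def cA4 (w : E) : E :=
    7091568 * w + 42086220 * w ^ 2 + 71157922 * w ^ 3 + 77735724 * w ^ 4 + 59157626 * w ^ 5 +
    42592 * w ^ 6 - 175692 * w ^ 7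

def cA3 (w : E) : E :=
    340736 + 6836016 * w + 19613616 * w ^ 2 + 1953908 * w ^ 3 + 44995786 * w ^ 4 + 14358828 * w
    ^ 5 + 1181928 * w ^ 6 - 527076 * w ^ 7

def cA2 (w : E) : E :=
    557568 + 3737448 * w + 1294216 * w ^ 2 - 22790592 * w ^ 3 - 21162658 * w ^ 4 - 21339318 * w
    ^ 5 + 1213872 * w ^ 6 + 407286 * w ^ 7

def cA1 (w : E) : E :=
    278784 + 670824 * w - 2433552 * w ^ 2 - 4813380 * w ^ 3 - 9120738 * w ^ 4 - 4363260 * w ^ 5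
    + 167706 * w ^ 7

def cA0 (w : E) : E :=
    50688 + 70752 * w - 27060 * w ^ 2 + 2282478 * w ^ 3 + 1842654 * w ^ 4 + 1935516 * w ^ 5 -
    165528 * w ^ 6 - 47916 * w ^ 7

def cA (w x : E) : E :=
    cU w * x ^ 6 + cA5 w * x ^ 5 + cA4 w * x ^ 4 + cA3 w * x ^ 3 + cA2 w * x ^ 2 + cA1 w * x +
    cA0 w

def cB4 (w : E) : E :=
    -143748 * w - 614922 * w ^ 2 - 308792 * w ^ 3 + 263538 * w ^ 4 + 101156 * w ^ 5

def cB3 (w : E) : E :=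
    -7744 - 158752 * w - 469964 * w ^ 2 - 81554 * w ^ 3 + 85184 * w ^ 4 + 39204 * w ^ 5

def cB2 (w : E) : E :=
    -11616 - 47432 * w + 31944 * w ^ 2 + 81554 * w ^ 3 - 141086 * w ^ 4 - 46464 * w ^ 5

def cB1 (w : E) : E :=
    -6336 - 6336 * w + 60060 * w ^ 2 - 990 * w ^ 3 - 31152 * w ^ 4 - 13068 * w ^ 5

def cB0 (w : E) : E :=
    -1056 - 660 * w + 5874 * w ^ 2 - 7722 * w ^ 3 + 15180 * w ^ 4 + 4356 * w ^ 5

def cB (w x : E) : E :=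
    cB4 w * x ^ 4 + cB3 w * x ^ 3 + cB2 w * x ^ 2 + cB1 w * x + cB0 w

def cL5 (w : E) : E :=
    -287496 * w - 1996500 * w ^ 2 - 2779128 * w ^ 3 + 2283996 * w ^ 4 - 423258 * w ^ 5 + 303468
    * w ^ 6

def cL4 (w : E) : E :=
    -1437480 * w - 8848488 * w ^ 2 - 12093466 * w ^ 3 + 2347884 * w ^ 4 + 3444628 * w ^ 5 +
    774642 * w ^ 6

def cL3 (w : E) : E :=
    -61952 - 1450064 * w - 5632792 * w ^ 2 - 3650812 * w ^ 3 - 614438 * w ^ 4 + 1526052 * w ^ 5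
    + 79860 * w ^ 6

def cL2 (w : E) : E :=
    -92928 - 571120 * w + 34848 * w ^ 2 + 2955304 * w ^ 3 - 1851058 * w ^ 4 - 1699566 * w ^ 5 -
    367356 * w ^ 6

def cL1 (w : E) : E :=
    -50688 - 157608 * w + 274956 * w ^ 2 + 362340 * w ^ 3 - 287430 * w ^ 4 - 481338 * w ^ 5 -
    60984 * w ^ 6

def cL0 (w : E) : E :=
    -8448 - 20328 * w - 21912 * w ^ 2 - 251262 * w ^ 3 + 211926 * w ^ 4 + 167706 * w ^ 5 +
    37026 * w ^ 6

def cL (w x : E) : E :=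
    cL5 w * x ^ 5 + cL4 w * x ^ 4 + cL3 w * x ^ 3 + cL2 w * x ^ 2 + cL1 w * x + cL0 w

def cE5 (w : E) : E :=
    47916 * w + 255552 * w ^ 2 + 271524 * w ^ 3 + 87846 * w ^ 4 + 31944 * w ^ 5 + 7986 * w ^ 6

def cE4 (w : E) : E :=
    69696 * w + 305646 * w ^ 2 + 350416 * w ^ 3 + 484968 * w ^ 4 + 78650 * w ^ 5 - 8954 * w ^ 6

def cE3 (w : E) : E :=
    3872 + 60984 * w + 135036 * w ^ 2 + 20570 * w ^ 3 + 187792 * w ^ 4 + 8712 * w ^ 5 - 4356 *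
    w ^ 6

def cE2 (w : E) : E :=
    6336 + 28512 * w - 17072 * w ^ 2 - 137346 * w ^ 3 - 150634 * w ^ 4 - 31812 * w ^ 5 + 8712 *
    w ^ 6

def cE1 (w : E) : E :=
    3168 + 1980 * w - 34188 * w ^ 2 - 18414 * w ^ 3 - 42438 * w ^ 4 - 4488 * w ^ 5 + 2178 * w ^
    6

def cE0 (w : E) : E :=
    576 - 384 * w - 3822 * w ^ 2 + 17250 * w ^ 3 + 12450 * w ^ 4 + 3234 * w ^ 5 - 990 * w ^ 6

def cE (w x : E) : E :=
    cE5 w * x ^ 5 + cE4 w * x ^ 4 + cE3 w * x ^ 3 + cE2 w * x ^ 2 + cE1 w * x + cE0 w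

def C0 (w : E) : E :=
    -294912 - 26222592 * w - 419353088 * w ^ 2 + 7679198208 * w ^ 3 - 2165965824 * w ^ 4 +
    5290948608 * w ^ 5 - 130205277312 * w ^ 6 + 139895809152 * w ^ 7 + 24058559712 * w ^ 8 +
    15275365248 * w ^ 9 + 1345097952 * w ^ 10 + 311794736 * w ^ 11

def C1 (w : E) : E :=
    10036224 * w - 58126464 * w ^ 2 - 1198074240 * w ^ 3 - 4093524864 * w ^ 4 + 1879387488 * w
    ^ 5 + 17413632720 * w ^ 6 - 19342155888 * w ^ 7 - 12765828636 * w ^ 8 + 3054932496 * w ^ 9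
    + 649884708 * w ^ 10 - 34787016 * w ^ 11

end cert

section cert2
variable {E : Type*} [Field E]

def gP (x : E) : E := (x ^ 4 + 4 / 3 * x ^ 3 + 2 / 3 * x ^ 2 - 1 / 11) ^ 2 *
  (x ^ 4 + 22 / 3 * x ^ 3 - 8 / 3 * x ^ 2 - 2 * x + 13 / 11)

def gQ (x : E) : E := (x ^ 2 - 3 / 11) ^ 3 * (x ^ 3 + x ^ 2 + 1 / 11 * x - 1 / 11)

lemma cert0 [CharZero E] (w x : E) :
    cA w x ^ 2 + cB w x ^ 2 * ((33 - 44 * w) * (33 * w ^ 2 + 264 * w + 64))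
      - (33 - 44 * w) * cL w x ^ 2 - 121 * cE w x ^ 2 * (33 * w ^ 2 + 264 * w + 64) =
    cU w ^ 2 * gP x - 21258732 * w * ch w * ca w * gQ x := by
  unfold cA cA5 cA4 cA3 cA2 cA1 cA0 cB cB4 cB3 cB2 cB1 cB0 cL cL5 cL4 cL3 cL2 cL1 cL0 cE cE5 cE4 cE3 cE2 cE1 cE0 cU gP gQ ch ca
  ring

lemma cert1 [CharZero E] (w x : E) :
    2 * cA w x * cB w x - 22 * cL w x * cE w x = - (21258732 * w * ch w * cb w * gQ x) := by
  unfold cA cA5 cA4 cA3 cA2 cA1 cA0 cB cB4 cB3 cB2 cB1 cB0 cL cL5 cL4 cL3 cL2 cL1 cL0 cE cE5 cE4 cE3 cE2 cE1 cE0 cU gQ ch cb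
  ring

lemma certF (w t : E) :
    (3267 * w * ch w ^ 3 * t - ca w) ^ 2 -
      cb w ^ 2 * ((33 - 44 * w) * (33 * w ^ 2 + 264 * w + 64)) =
    11 * ch w ^ 3 * (970299 * w ^ 2 * ch w ^ 3 * t ^ 2 + C1 w * t + C0 w) := by
  unfold ch ca cb C0 C1
  ring

lemma cert [CharZero E] {t w y n : E} (hy : y ^ 2 = 33 - 44 * w)
    (hn : n ^ 2 = 33 * w ^ 2 + 264 * w + 64)
    (ht : 3267 * w * ch w ^ 3 * t = ca w + cb w * y * n) (x : E) :
    cU w ^ 2 * (gP x - t * gQ x) =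
      (cA w x + cB w x * (y * n) + (y * cL w x + 11 * n * cE w x)) *
      (cA w x + cB w x * (y * n) - (y * cL w x + 11 * n * cE w x)) := by
  have h0 := cert0 w x
  have h1 := cert1 w x
  have hU : cU w ^ 2 * t = 21258732 * w * ch w * (ca w + cb w * y * n) := by
    rw [← ht]; unfold cU ch; ring
  generalize cA w x = A at *
  generalize cB w x = B at *
  generalize cL w x = L at *
  generalize cE w x = F at *
  linear_combination (-1) * h0 - y * n * h1 - gQ x * hU - B ^ 2 * n ^ 2 * hy
    - B ^ 2 * (33 - 44 * w) * hn + L ^ 2 * hy + 121 * F ^ 2 * hn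

end cert2
end M11

namespace M11
open Polynomial
open scoped Pointwise

section hom
variable {E F : Type*} [CommRing E] [CommRing F] (f : E →+* F)

lemma map_ca (w : E) : f (ca w) = ca (f w) := by simp [map_ofNat, ca]
lemma map_cb (w : E) : f (cb w) = cb (f w) := by simp [map_ofNat, cb]
lemma map_ch (w : E) : f (ch w) = ch (f w) := by simp [map_ofNat, ch]
lemma map_cC0 (w : E) : f (C0 w) = C0 (f w) := by simp [map_ofNat, C0]
lemma map_cC1 (w : E) : f (C1 w) = C1 (f w) := by simp [map_ofNat, C1]
lemma map_cA (w x : E) : f (cA w x) = cA (f w) (f x) := by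
  simp [map_ofNat, cA, cA5, cA4, cA3, cA2, cA1, cA0, cU]
lemma map_cB (w x : E) : f (cB w x) = cB (f w) (f x) := by
  simp [map_ofNat, cB, cB4, cB3, cB2, cB1, cB0]
lemma map_cL (w x : E) : f (cL w x) = cL (f w) (f x) := by
  simp [map_ofNat, cL, cL5, cL4, cL3, cL2, cL1, cL0]
lemma map_cE (w x : E) : f (cE w x) = cE (f w) (f x) := by
  simp [map_ofNat, cE, cE5, cE4, cE3, cE2, cE1, cE0]

lemma bez (w : E) : (-310729879644130147782260 + 9562698980511494057922 * w
    - 38544724316831608353665 * w ^ 2) * C0 w + (29640128999212555560323829853952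
    - 122633177347567916968524468878336 * w + 425499637834978030309258592664576 * w ^ 2
    - 522240745988098848305982556208512 * w ^ 3 + 1768965567702190101839913540296448 * w ^ 4
    - 6308231649103363027486661927126016 * w ^ 5 + 5197670743100616991459909453356992 * w ^ 6
    + 784264228045298757140905524002560 * w ^ 7 + 576661579159270593056469538582016 * w ^ 8
    + 48864830534898745090625524495488 * w ^ 9 + 12018042142559291683086373307440 * w ^ 10) * ch w
    = 59371895968690720830790421569024 := by
  unfold C0 ch; ring

end hom

section blk
variable {E : Type*} [Field E] [Algebra ℚ E]

/-- the equation for `w` -/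
def cF (t w : E) : E := 970299 * w ^ 2 * ch w ^ 3 * t ^ 2 + C1 w * t + C0 w

def fw (y : E) : E := (33 - y ^ 2) / 44
def fn (t y : E) : E := (3267 * fw y * ch (fw y) ^ 3 * t - ca (fw y)) / (cb (fw y) * y)
def fS (t y x : E) : E := cA (fw y) x + cB (fw y) x * (y * fn t y) +
  (y * cL (fw y) x + 11 * fn t y * cE (fw y) x)

lemma alg_of {w : E} (p : ℚ[X]) (hp : p ≠ 0) (hw : aeval w p = 0) (t : E)
    (ht : Transcendental ℚ t) : ∃ w' : algebraicClosure ℚ E, (w' : E) = w ∧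
      ∀ a b : algebraicClosure ℚ E, (b : E) ≠ 0 → t * b ≠ a := by
  refine ⟨⟨w, ?_⟩, rfl, ?_⟩
  · rw [mem_algebraicClosure_iff]; exact ⟨p, hp, hw⟩
  · intro a b hb e
    apply ht
    rw [← mem_algebraicClosure_iff]
    have : t = ((a / b : algebraicClosure ℚ E) : E) := by
      push_cast; rw [← e, mul_div_cancel_right₀ _ hb]
    rw [this]; exact (a / b).2

variable {t w y : E} (ht : Transcendental ℚ t) (hF : cF t w = 0)
include ht hF

lemma w_ne : w ≠ 0 := by
  have : CharZero E := algebraRat.charZero E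
  rintro rfl
  unfold cF C0 C1 at hF
  norm_num at hF

lemma h_ne : ch w ≠ 0 := by
  have : CharZero E := algebraRat.charZero E
  intro hh
  obtain ⟨w', rfl, H⟩ := alg_of (w := w) (X ^ 3 + 8 * X + 2 : ℚ[X]) (by
      intro e; have := congrArg (eval 0) e; norm_num at this)
      (by simpa [ch, map_ofNat] using hh) t ht
  unfold cF at hF
  rw [hh] at hF
  have e1 := map_cC1 (algebraMap (algebraicClosure ℚ E) E) w'
  have e0 := map_cC0 (algebraMap (algebraicClosure ℚ E) E) w'
  by_cases h1 : C1 (w' : E) = 0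
  · have hC0 : C0 (w' : E) = 0 := by rw [h1] at hF; simpa using hF
    have := bez (w' : E)
    rw [hC0, hh] at this
    norm_num at this
  · apply H (-C0 w') (C1 w')
    · exact (e1.symm ▸ h1 : algebraMap (algebraicClosure ℚ E) E (C1 w') ≠ 0)
    · push_cast
      change t * algebraMap (algebraicClosure ℚ E) E (C1 w') =
        - algebraMap (algebraicClosure ℚ E) E (C0 w')
      rw [e1, e0]
      change t * C1 (w' : E) = - C0 (w' : E)
      linear_combination hF

lemma aux_ne (p : ℚ[X]) (hp : p ≠ 0) (hw : aeval w p = 0)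
    (h0 : cb w ^ 2 * ((33 - 44 * w) * (33 * w ^ 2 + 264 * w + 64)) = 0) : False := by
  have : CharZero E := algebraRat.charZero E
  have hw0 := w_ne ht hF
  have hh0 := h_ne ht hF
  obtain ⟨w', rfl, H⟩ := alg_of p hp hw t ht
  have h1 := certF (w' : E) t
  rw [h0, sub_zero] at h1
  unfold cF at hF
  rw [hF, mul_zero] at h1
  have h2 := pow_eq_zero_iff (two_ne_zero) |>.1 h1
  have ea := map_ca (algebraMap (algebraicClosure ℚ E) E) w'
  have eh := map_ch (algebraMap (algebraicClosure ℚ E) E) w'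
  have e3 : ((3267 * w' * ch w' ^ 3 : algebraicClosure ℚ E) : E) = 3267 * (w' : E) * ch (w' : E) ^ 3 := by
    push_cast
    rw [show ((ch w' : algebraicClosure ℚ E) : E) = ch (w' : E) from eh]
    rfl
  apply H (ca w') (3267 * w' * ch w' ^ 3)
  · rw [e3]
    exact mul_ne_zero (mul_ne_zero (by norm_num) hw0) (pow_ne_zero _ hh0)
  · rw [e3, show ((ca w' : algebraicClosure ℚ E) : E) = ca (w' : E) from ea]
    linear_combination h2

lemma b_ne : cb w ≠ 0 := by
  intro hb
  apply aux_ne ht hF (cb X) _ _ (by rw [hb]; ring)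
  · intro e; have := congrArg (eval 0) e; norm_num [cb] at this
  · rw [← hb]
    have := map_cb ((aeval w : ℚ[X] →ₐ[ℚ] E) : ℚ[X] →+* E) X
    simpa using this

lemma q_ne : 33 - 44 * w ≠ 0 := by
  intro hb
  apply aux_ne ht hF (33 - 44 * X) _ _ (by rw [hb]; ring)
  · intro e; have := congrArg (eval 0) e; norm_num at this
  · simpa [map_ofNat] using hb

end blk

section blk2
variable {E : Type*} [Field E] [Algebra ℚ E] {t y : E} (ht : Transcendental ℚ t)
  (hF : cF t (fw y) = 0)
include ht hF

lemma y_sq : y ^ 2 = 33 - 44 * fw y := by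
  have : CharZero E := algebraRat.charZero E
  unfold fw; field_simp; ring

lemma y_ne : y ≠ 0 := by
  intro h
  apply q_ne ht hF
  rw [← y_sq ht hF, h]; ring

lemma n_mul : 3267 * fw y * ch (fw y) ^ 3 * t = ca (fw y) + cb (fw y) * y * fn t y := by
  unfold fn
  rw [mul_div_cancel₀ _ (mul_ne_zero (b_ne ht hF) (y_ne ht hF))]
  ring

lemma n_sq : fn t y ^ 2 = 33 * fw y ^ 2 + 264 * fw y + 64 := by
  have h1 := certF (fw y) t
  have h2 := n_mul ht hF
  have h3 := y_sq ht hF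
  have hF' := hF
  unfold cF at hF'
  rw [hF', mul_zero, h2, ← h3] at h1
  have h4 : (cb (fw y) * y) ^ 2 * (fn t y ^ 2 - (33 * fw y ^ 2 + 264 * fw y + 64)) = 0 := by
    linear_combination h1
  rcases mul_eq_zero.1 h4 with h | h
  · exact absurd h (pow_ne_zero _ (mul_ne_zero (b_ne ht hF) (y_ne ht hF)))
  · exact sub_eq_zero.1 h

lemma U_ne : cU (fw y) ≠ 0 := by
  have : CharZero E := algebraRat.charZero E
  have h1 := w_ne ht hF
  have h2 := h_ne ht hF
  unfold cU
  unfold ch at h2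
  exact mul_ne_zero (mul_ne_zero (by norm_num) h1) (pow_ne_zero _ h2)

omit ht hF in
lemma fw_neg : fw (-y) = fw y := by unfold fw; ring

omit ht hF in
lemma fn_neg : fn t (-y) = - fn t y := by
  unfold fn; rw [fw_neg, mul_neg, div_neg]

lemma fS_mul (x : E) : cU (fw y) ^ 2 * (gP x - t * gQ x) = fS t y x * fS t (-y) x := by
  have : CharZero E := algebraRat.charZero E
  rw [cert (y_sq ht hF) (n_sq ht hF) (n_mul ht hF)]
  unfold fS
  rw [fw_neg, fn_neg]
  ring

lemma fS_card (R : Finset E) (hR : ∀ x ∈ R, fS t y x = 0) : R.card ≤ 6 := by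
  classical
  have hU := U_ne ht hF
  obtain ⟨c5, c4, c3, c2, c1, c0, hc⟩ : ∃ c5 c4 c3 c2 c1 c0 : E, ∀ x, fS t y x =
      cU (fw y) * x ^ 6 + c5 * x ^ 5 + c4 * x ^ 4 + c3 * x ^ 3 + c2 * x ^ 2 + c1 * x + c0 := by
    let w := fw y
    let n := fn t y
    refine ⟨cA5 w + y * cL5 w + 11 * n * cE5 w,
      cA4 w + cB4 w * (y * n) + y * cL4 w + 11 * n * cE4 w,
      cA3 w + cB3 w * (y * n) + y * cL3 w + 11 * n * cE3 w,
      cA2 w + cB2 w * (y * n) + y * cL2 w + 11 * n * cE2 w,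
      cA1 w + cB1 w * (y * n) + y * cL1 w + 11 * n * cE1 w,
      cA0 w + cB0 w * (y * n) + y * cL0 w + 11 * n * cE0 w, fun x => ?_⟩
    unfold fS cA cB cL cE
    ring
  let p : E[X] := C (cU (fw y)) * X ^ 6 + C c5 * X ^ 5 + C c4 * X ^ 4 + C c3 * X ^ 3
    + C c2 * X ^ 2 + C c1 * X + C c0
  have hd : p.natDegree = 6 := by
    unfold p; compute_degree!
  have hp0 : p ≠ 0 := by intro e; rw [e] at hd; simp at hd
  have hsub : R ⊆ p.roots.toFinset := by
    intro x hx
    rw [Multiset.mem_toFinset, mem_roots hp0]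
    have := hR x hx
    rw [hc] at this
    simpa [p] using this
  calc R.card ≤ p.roots.toFinset.card := Finset.card_le_card hsub
    _ ≤ p.roots.card := Multiset.toFinset_card_le _
    _ ≤ 6 := hd ▸ card_roots' p

end blk2
end M11

namespace M11
open Polynomial
open scoped Pointwise

section blk3

lemma t_tr : Transcendental ℚ (_root_.t) := by
  have h := RatFunc.transcendental_X (K := ℚ)
  convert h
  · exact Subsingleton.elim _ _
  · rfl

lemma lead_ne : (970299 * _root_.t ^ 2 - 34787016 * _root_.t + 311794736 : RatFunc ℚ) ≠ 0 := by
  intro e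
  apply t_tr
  refine ⟨970299 * X ^ 2 - 34787016 * X + 311794736, ?_, by simpa [map_ofNat] using e⟩
  intro e; have := congrArg (eval 0) e; norm_num at this

noncomputable def Psi : (RatFunc ℚ)[X] :=
  970299 * X ^ 2 * ch X ^ 3 * C _root_.t ^ 2 + C1 X * C _root_.t + C0 X

noncomputable def Phi : (RatFunc ℚ)[X] := Psi.comp (C (1 / 44) * (33 - X ^ 2))

lemma Psi_deg : Psi.natDegree = 11 := by
  have h : Psi.coeff 11 ≠ 0 := by
    have := lead_ne
    unfold Psi ch C0 C1
    convert this using 1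
    compute_degree
    all_goals first | (norm_num; done) | ring
  apply natDegree_eq_of_le_of_coeff_ne_zero _ h
  unfold Psi ch C0 C1
  compute_degree!

lemma Phi_deg : Phi.natDegree = 22 := by
  unfold Phi
  rw [natDegree_comp, Psi_deg]
  have : (C (1 / 44) * (33 - X ^ 2) : (RatFunc ℚ)[X]).natDegree = 2 := by
    rw [natDegree_C_mul (by norm_num)]
    compute_degree!
  rw [this]

variable {E : Type*} [Field E] [Algebra (RatFunc ℚ) E]

variable (E) in
noncomputable def tE : E := algebraMap (RatFunc ℚ) E _root_.t

lemma aeval_g (x : E) : aeval x _root_.g = gP x - tE E * gQ x := by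
  unfold _root_.g gP gQ tE
  simp [map_ofNat, map_div₀]

variable [Algebra ℚ E] [IsScalarTower ℚ (RatFunc ℚ) E]

lemma tE_tr : Transcendental ℚ (tE E) :=
  (transcendental_algebraMap_iff (algebraMap (RatFunc ℚ) E).injective).2 t_tr

lemma aeval_Phi (y : E) : aeval y Phi = cF (tE E) (fw y) := by
  have : CharZero E := algebraRat.charZero E
  unfold Phi Psi cF fw
  rw [aeval_comp]
  have h : aeval y (C (1 / 44) * (33 - X ^ 2) : (RatFunc ℚ)[X]) = (33 - y ^ 2) / 44 := by
    simp [map_ofNat, map_div₀]; ring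
  rw [h]
  generalize (33 - y ^ 2) / 44 = w
  let f : (RatFunc ℚ)[X] →+* E := ((aeval w : (RatFunc ℚ)[X] →ₐ[RatFunc ℚ] E) : (RatFunc ℚ)[X] →+* E)
  have e1 := map_cC1 f X
  have e0 := map_cC0 f X
  have eh := map_ch f X
  have hX : f X = w := by simp [f]
  have hC : f (C _root_.t) = tE E := by simp [f, tE]
  change f _ = _
  rw [map_add, map_add, map_mul, map_mul, map_mul, map_mul, e1, e0, map_pow, map_pow, map_pow, eh, hX, hC,
    map_ofNat]

lemma fS_map (τ : E ≃ₐ[RatFunc ℚ] E) (y x : E) : τ (fS (tE E) y x) = fS (tE E) (τ y) (τ x) := by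
  have : CharZero E := algebraRat.charZero E
  let f : E →+* E := (τ : E →+* E)
  have ht : f (tE E) = tE E := by simp [f, tE]
  have hw : f (fw y) = fw (f y) := by simp [fw, map_ofNat]
  have hn : f (fn (tE E) y) = fn (tE E) (f y) := by
    unfold fn
    rw [map_div₀, map_sub, map_mul, map_mul, map_mul, map_mul, map_pow, map_ca, map_cb, map_ch, hw, ht,
      map_ofNat]
  change f _ = fS (tE E) (f y) (f x)
  unfold fS
  rw [map_add, map_add, map_add, map_mul, map_mul, map_mul, map_mul, map_mul, map_cA, map_cB, map_cL, map_cE,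
    hw, hn, map_ofNat]

variable [IsAlgClosed E] [Normal (RatFunc ℚ) E]
  [Fact ((_root_.g.map (algebraMap (RatFunc ℚ) E)).Splits)]

open Classical in
theorem blocks_ex (hX : Fintype.card (_root_.g.rootSet E) = 12) :
    ∃ S : Finset (Finset (_root_.g.rootSet E)), Blocks (_root_.g.Gal) S := by
  have : CharZero E := algebraRat.charZero E
  have ht := tE_tr (E := E)
  have hP0 : Phi ≠ 0 := by intro e; have := Phi_deg; rw [e] at this; simp at this
  let Y : Finset E := (Phi.map (algebraMap (RatFunc ℚ) E)).roots.toFinset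
  have hY : ∀ y, y ∈ Y ↔ cF (tE E) (fw y) = 0 := by
    intro y
    rw [Multiset.mem_toFinset, mem_roots_map hP0, ← aeval_Phi, aeval_def]
  let Bl : E → Finset (_root_.g.rootSet E) := fun y => Finset.univ.filter (fun x => fS (tE E) y x = 0)
  have hmem : ∀ y x, x ∈ Bl y ↔ fS (tE E) y x = 0 := by intro y x; simp [Bl]
  have hg0 : _root_.g ≠ 0 := by
    intro e
    have h1 : Fintype.card (_root_.g.rootSet E) = 0 := by
      rw [Fintype.card_eq_zero_iff]
      constructor
      rintro ⟨x, hx⟩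
      rw [mem_rootSet] at hx
      exact hx.1 e
    omega
  have hneg : ∀ y ∈ Y, -y ∈ Y := by
    intro y hy
    rw [hY] at hy ⊢
    rwa [fw_neg]
  have hle : ∀ y ∈ Y, (Bl y).card ≤ 6 := by
    intro y hy
    rw [← Finset.card_image_of_injective (Bl y) Subtype.val_injective]
    apply fS_card ht ((hY y).1 hy)
    intro x hx
    obtain ⟨z, hz, rfl⟩ := Finset.mem_image.1 hx
    exact (hmem _ _).1 hz
  have hun : ∀ y ∈ Y, Bl y ∪ Bl (-y) = Finset.univ := by
    intro y hy
    ext x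
    simp only [Finset.mem_union, Finset.mem_univ, iff_true, hmem]
    have h1 := fS_mul ht ((hY y).1 hy) (x : E)
    have h2 := (mem_rootSet.1 x.2).2
    rw [aeval_g] at h2
    rw [h2, mul_zero] at h1
    exact mul_eq_zero.1 h1.symm
  have hcard : ∀ y ∈ Y, (Bl y).card = 6 ∧ (Bl y)ᶜ = Bl (-y) := by
    intro y hy
    have h1 := hle y hy
    have h2 := hle _ (hneg y hy)
    have h3 := Finset.card_union_le (Bl y) (Bl (-y))
    rw [hun y hy, Finset.card_univ, hX] at h3
    refine ⟨by omega, ?_⟩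
    apply Finset.eq_of_subset_of_card_le
    · intro x hx
      have : x ∈ Bl y ∪ Bl (-y) := by rw [hun y hy]; exact Finset.mem_univ _
      rcases Finset.mem_union.1 this with h | h
      · exact absurd h (Finset.mem_compl.1 hx)
      · exact h
    · rw [Finset.card_compl, hX]; omega
  refine ⟨Y.image Bl, ?_, ?_, ?_, ?_, ?_⟩
  · obtain ⟨y, hy⟩ := IsAlgClosed.exists_aeval_eq_zero E Phi (by
      intro e; have := natDegree_eq_of_degree_eq_some (n := 0) e; rw [Phi_deg] at this; omega)
    exact ⟨Bl y, Finset.mem_image_of_mem _ ((hY y).2 (by rw [← aeval_Phi]; exact hy))⟩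
  · calc (Y.image Bl).card ≤ Y.card := Finset.card_image_le
      _ ≤ (Phi.map (algebraMap (RatFunc ℚ) E)).roots.card := Multiset.toFinset_card_le _
      _ ≤ (Phi.map (algebraMap (RatFunc ℚ) E)).natDegree := card_roots' _
      _ = 22 := by rw [natDegree_map, Phi_deg]
  · intro B hB
    obtain ⟨y, hy, rfl⟩ := Finset.mem_image.1 hB
    exact (hcard y hy).1
  · intro B hB
    obtain ⟨y, hy, rfl⟩ := Finset.mem_image.1 hB
    rw [(hcard y hy).2]
    exact Finset.mem_image_of_mem _ (hneg y hy)
  · intro γ B hB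
    obtain ⟨y, hy, rfl⟩ := Finset.mem_image.1 hB
    obtain ⟨τ, rfl⟩ := Gal.restrict_surjective _root_.g E γ
    have hτ : τ y ∈ Y := by
      rw [hY, ← aeval_Phi] at hy ⊢
      have := aeval_algHom_apply (τ : E →ₐ[RatFunc ℚ] E) y Phi
      rw [hy, map_zero] at this
      exact this
    refine Finset.mem_image.2 ⟨τ y, hτ, ?_⟩
    symm
    apply Finset.eq_of_subset_of_card_le
    · intro x hx
      obtain ⟨z, hz, rfl⟩ := Finset.mem_smul_finset.1 hx
      rw [hmem] at hz ⊢
      rw [Gal.restrict_smul, ← fS_map, hz, map_zero]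
    · rw [Finset.card_smul_finset, (hcard y hy).1, (hcard _ hτ).1]

end blk3
end M11

namespace M11
open Polynomial

section frob
universe u
variable (A K : Type*) (L : Type u) [CommRing A] [IsDomain A] [IsIntegrallyClosed A] [IsNoetherianRing A]
  [Field K] [Field L] [Algebra A K] [IsFractionRing A K] [Algebra K L] [Algebra A L]
  [IsScalarTower A K L] [FiniteDimensional K L] [IsGalois K L]

theorem frob_ex (p : ℕ) [Fact p.Prime] (φ : A →+* ZMod p) (hφ : Function.Surjective φ) :
    ∃ (k : Type u) (_ : Field k) (_ : Algebra (ZMod p) k) (π : integralClosure A L →+* k)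
      (σ : L ≃ₐ[K] L), (∀ a, π (algebraMap A _ a) = algebraMap (ZMod p) k (φ a)) ∧
      ∀ b c : integralClosure A L, (c : L) = σ b → π c = π b ^ p := by
  let B := integralClosure A L
  have : Module.Finite A B := IsIntegralClosure.finite A K L B
  have : IsFractionRing B L := integralClosure.isFractionRing_of_finite_extension K L
  let := IsIntegralClosure.MulSemiringAction A K L B
  have := Algebra.isInvariant_of_isGalois A K L B
  have : SMulCommClass (L ≃ₐ[K] L) A B := ⟨fun s a b => map_smul (galRestrict A K L B s) a b⟩
  have hinj : Function.Injective (algebraMap A B) := by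
    have h : Function.Injective (algebraMap A L) := by
      rw [IsScalarTower.algebraMap_eq A K L]
      exact (algebraMap K L).injective.comp (IsFractionRing.injective A K)
    rw [IsScalarTower.algebraMap_eq A B L, RingHom.coe_comp] at h
    exact Function.Injective.of_comp h
  let P : Ideal A := RingHom.ker φ
  have hP : P.IsMaximal := RingHom.ker_isMaximal_of_surjective φ hφ
  obtain ⟨Q, hQ, hQP⟩ := Ideal.exists_ideal_over_maximal_of_isIntegral (S := B) P (by
    rw [(RingHom.injective_iff_ker_eq_bot _).1 hinj]; exact bot_le)
  let eφ : A ⧸ P ≃+* ZMod p := RingHom.quotientKerEquivOfSurjective hφ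
  let k := B ⧸ Q
  let _ : Field k := Ideal.Quotient.field Q
  let i0 : A ⧸ P →+* k := Ideal.quotientMap Q (algebraMap A B) (le_of_eq hQP.symm)
  let i : ZMod p →+* k := i0.comp eφ.symm.toRingHom
  have hia : ∀ a, (Ideal.Quotient.mk Q (algebraMap A B a)) = i (φ a) := by
    intro a
    have : eφ.symm (φ a) = Ideal.Quotient.mk P a := by
      rw [RingEquiv.symm_apply_eq]; rfl
    change _ = i0 (eφ.symm (φ a))
    rw [this]
    rfl
  have hfin : Finite (B ⧸ Q) := by
    have h1 : Module.Finite A k := by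
      exact Module.Finite.of_surjective (Ideal.Quotient.mkₐ A Q).toLinearMap
        Ideal.Quotient.mk_surjective
    let _ : Algebra (ZMod p) k := i.toAlgebra
    have h2 : Module.Finite (ZMod p) k := by
      let _ : Algebra A (ZMod p) := φ.toAlgebra
      have : IsScalarTower A (ZMod p) k := by
        refine ⟨fun a z x => ?_⟩
        rw [Algebra.smul_def, Algebra.smul_def, Algebra.smul_def, map_mul, mul_assoc]
        have := hia a
        rw [Algebra.smul_def]
        congr 1
        exact this.symm
      exact Module.Finite.of_restrictScalars_finite A (ZMod p) k
    exact Module.finite_of_finite (ZMod p)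
  obtain ⟨σ, hσ⟩ := IsArithFrobAt.exists_of_isInvariant A (L ≃ₐ[K] L) Q
  have hcard : Nat.card (A ⧸ Q.under A) = p := by
    have : Q.under A = P := hQP
    rw [this, Nat.card_congr eφ.toEquiv, Nat.card_zmod]
  refine ⟨k, inferInstance, i.toAlgebra, Ideal.Quotient.mk Q, σ, hia, ?_⟩
  intro b c hbc
  have h1 := hσ b
  rw [hcard] at h1
  have h2 : (MulSemiringAction.toAlgHom A B σ) b = c := by
    apply Subtype.val_injective
    rw [hbc]
    exact algebraMap_galRestrict_apply A σ b
  rw [h2] at h1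
  rw [← map_pow]
  exact (Ideal.Quotient.mk_eq_mk_iff_sub_mem _ _).2 h1

end frob
end M11

namespace M11
open Polynomial

section frob2
universe u
variable (A K : Type*) (L : Type u) [CommRing A] [IsDomain A] [IsIntegrallyClosed A] [IsNoetherianRing A]
  [Field K] [Field L] [Algebra A K] [IsFractionRing A K] [Algebra K L] [Algebra A L]
  [IsScalarTower A K L] [FiniteDimensional K L] [IsGalois K L]

theorem frob_roots (p : ℕ) [Fact p.Prime] (φ : A →+* ZMod p) (hφ : Function.Surjective φ)
    (f : A[X]) (hf : f.Monic) (hs : (f.map (algebraMap A L)).Splits) (hsep : (f.map φ).Separable) :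
    ∃ (k : Type u) (_ : Field k) (_ : Algebra (ZMod p) k) (σ : L ≃ₐ[K] L)
      (e : f.rootSet L ≃ (f.map φ).rootSet k),
      (∀ b b' : f.rootSet L, (b' : L) = σ b → (e b' : k) = (e b : k) ^ p) ∧
      Fintype.card (f.rootSet L) = f.natDegree := by
  classical
  obtain ⟨k, _, _, π, σ, hπ, hσ⟩ := frob_ex A K L p φ hφ
  refine ⟨k, inferInstance, inferInstance, σ, ?_⟩
  let B := integralClosure A L
  let fL := f.map (algebraMap A L)
  have hfL : fL.Monic := hf.map _
  have hint : ∀ b ∈ f.rootSet L, IsIntegral A b := by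
    intro b hb
    exact ⟨f, hf, by have := (mem_rootSet'.1 hb).2; rwa [aeval_def] at this⟩
  have hmemr : ∀ b, b ∈ fL.roots ↔ b ∈ f.rootSet L := by
    intro b
    rw [mem_rootSet', mem_roots hfL.ne_zero, IsRoot.def, eval_map, aeval_def]
    exact ⟨fun h => ⟨hfL.ne_zero, h⟩, fun h => h.2⟩
  let bs : Multiset B := fL.roots.pmap (fun b hb => (⟨b, hint b hb⟩ : B)) (fun b hb => (hmemr b).1 hb)
  have hbs : bs.map (algebraMap B L) = fL.roots := by
    simp only [bs]
    rw [Multiset.map_pmap]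
    conv_rhs => rw [← Multiset.map_id fL.roots]
    exact Multiset.pmap_eq_map _ _ _ _
  have hprod : fL = (fL.roots.map (fun a => X - C a)).prod := by
    have h := hs.eq_prod_roots
    rwa [show (f.map (algebraMap A L)).leadingCoeff = 1 from hfL, C_1, one_mul] at h
  have hBinj : Function.Injective (algebraMap B L) := Subtype.val_injective
  have hB : f.map (algebraMap A B) = (bs.map (fun b => X - C b)).prod := by
    apply map_injective (algebraMap B L) hBinj
    rw [Polynomial.map_map, ← IsScalarTower.algebraMap_eq, Polynomial.map_multiset_prod, Multiset.map_map]
    change fL = _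
    rw [hprod, ← hbs, Multiset.map_map]
    congr 1
    apply Multiset.map_congr rfl
    intro b _
    simp
  let fk := (f.map φ).map (algebraMap (ZMod p) k)
  have hk : fk = ((bs.map π).map (fun b => X - C b)).prod := by
    have h1 : fk = (f.map (algebraMap A B)).map π := by
      simp only [fk]
      rw [Polynomial.map_map, Polynomial.map_map]
      congr 1
      ext a
      exact (hπ a).symm
    rw [h1, hB, Polynomial.map_multiset_prod, Multiset.map_map, Multiset.map_map]
    congr 1
    apply Multiset.map_congr rfl
    intro b _
    simp
  have hkr : fk.roots = bs.map π := by rw [hk, roots_multiset_prod_X_sub_C]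
  have hkm : fk.Monic := (hf.map _).map _
  have hnd : (bs.map π).Nodup := by
    rw [← hkr]
    exact nodup_roots hsep.map
  have hndb : bs.Nodup := Multiset.Nodup.of_map _ hnd
  have hpinj : ∀ b ∈ bs, ∀ c ∈ bs, π b = π c → b = c := by
    intro b hb c hc h
    exact Multiset.inj_on_of_nodup_map hnd b hb c hc h
  have hmb : ∀ b : f.rootSet L, (⟨b, hint b b.2⟩ : B) ∈ bs := by
    intro b
    exact Multiset.mem_pmap.2 ⟨b, (hmemr _).2 b.2, rfl⟩
  have hmk : ∀ x, x ∈ (f.map φ).rootSet k ↔ x ∈ bs.map π := by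
    intro x
    rw [← hkr, mem_rootSet', mem_roots hkm.ne_zero, IsRoot.def, eval_map, aeval_def]
    exact ⟨fun h => h.2, fun h => ⟨hkm.ne_zero, h⟩⟩
  let e0 : f.rootSet L → (f.map φ).rootSet k := fun b => ⟨π ⟨b, hint b b.2⟩,
    (hmk _).2 (Multiset.mem_map_of_mem _ (hmb b))⟩
  have he0 : Function.Bijective e0 := by
    constructor
    · intro b c h
      have := hpinj _ (hmb b) _ (hmb c) (congrArg Subtype.val h)
      exact Subtype.ext (congrArg (algebraMap B L) this)
    · rintro ⟨x, hx⟩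
      obtain ⟨b, hb, rfl⟩ := Multiset.mem_map.1 ((hmk x).1 hx)
      obtain ⟨c, hc, rfl⟩ := Multiset.mem_pmap.1 hb
      exact ⟨⟨c, (hmemr c).1 hc⟩, rfl⟩
  refine ⟨Equiv.ofBijective e0 he0, ?_, ?_⟩
  · intro b b' h
    exact hσ _ _ h
  · have hndr : fL.roots.Nodup := by
      rw [← hbs]
      exact hndb.map hBinj
    have h1 : fL.roots.card = f.natDegree := by
      rw [← hs.natDegree_eq_card_roots, hf.natDegree_map]
    rw [← h1, ← Multiset.toFinset_card_of_nodup hndr]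
    rw [Fintype.card_of_subtype]
    intro x
    rw [Multiset.mem_toFinset, hmemr]

end frob2
end M11

namespace M11
open Polynomial

section spec

def fb {R : Type*} [CommRing R] (c x : R) : R :=
  (x ^ 4 + 44 * x ^ 3 + 726 * x ^ 2 - 107811) ^ 2 *
    (x ^ 4 + 242 * x ^ 3 - 2904 * x ^ 2 - 71874 * x + 1401543) -
  35937 * c * ((x ^ 2 - 297) ^ 3 * (x ^ 3 + 33 * x ^ 2 + 99 * x - 3267))

lemma map_fb {R S : Type*} [CommRing R] [CommRing S] (f : R →+* S) (c x : R) :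
    f (fb c x) = fb (f c) (f x) := by simp [fb, map_ofNat]

@[reducible] noncomputable def algZ : Algebra ℤ[X] (RatFunc ℚ) :=
  ((algebraMap ℚ[X] (RatFunc ℚ)).comp (mapRingHom (algebraMap ℤ ℚ))).toAlgebra

attribute [local instance] algZ

lemma algZ_apply (a : ℤ[X]) : algebraMap ℤ[X] (RatFunc ℚ) a =
    algebraMap ℚ[X] (RatFunc ℚ) (a.map (algebraMap ℤ ℚ)) := rfl

lemma algZ_inj : Function.Injective (algebraMap ℤ[X] (RatFunc ℚ)) := by
  apply Function.Injective.comp (IsFractionRing.injective ℚ[X] (RatFunc ℚ))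
  exact map_injective _ (algebraMap ℤ ℚ).injective_int

lemma frZ : IsFractionRing ℤ[X] (RatFunc ℚ) := by
  have : FaithfulSMul ℤ[X] (RatFunc ℚ) := (faithfulSMul_iff_algebraMap_injective _ _).2 algZ_inj
  have key : ∀ q : ℚ[X], ∃ (a : ℤ[X]) (b : ℤ), b ≠ 0 ∧
      a.map (algebraMap ℤ ℚ) = C (b : ℚ) * q := by
    intro q
    obtain ⟨b, hb0, hb⟩ := IsLocalization.integerNormalization_spec (nonZeroDivisors ℤ) q
    refine ⟨_, b, nonZeroDivisors.ne_zero hb0, hb.trans ?_⟩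
    rw [← smul_eq_C_mul, Int.cast_smul_eq_zsmul]
  apply IsFractionRing.of_field
  intro z
  obtain ⟨a, b, hb, hab⟩ := key z.num
  obtain ⟨c, d, hd, hcd⟩ := key z.denom
  refine ⟨a * C d, c * C b, ?_⟩
  simp only [algZ_apply, Polynomial.map_mul, hab, hcd, map_C, map_mul]
  have e1 : algebraMap ℚ[X] (RatFunc ℚ) (C (b : ℚ)) ≠ 0 := by simp [hb]
  have e2 : algebraMap ℚ[X] (RatFunc ℚ) (C (d : ℚ)) ≠ 0 := by simp [hd]
  have e3 : algebraMap ℚ[X] (RatFunc ℚ) z.denom ≠ 0 := RatFunc.algebraMap_ne_zero z.denom_ne_zero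
  have e4 := RatFunc.num_div_denom z
  rw [div_eq_iff e3] at e4
  simp only [eq_intCast] at *
  rw [e4]
  field_simp

noncomputable def fA : ℤ[X][X] := fb (C X) X

lemma fA_deg : fA.natDegree = 12 := by
  unfold fA fb
  compute_degree!

lemma fA_monic : fA.Monic := by
  unfold fA fb
  monicity!

noncomputable def phi (p : ℕ) (c : ZMod p) : ℤ[X] →+* ZMod p := eval₂RingHom (Int.castRingHom _) c

lemma phi_surj (p : ℕ) [NeZero p] (c : ZMod p) : Function.Surjective (phi p c) := by
  intro z
  obtain ⟨n, rfl⟩ := ZMod.intCast_surjective z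
  exact ⟨C n, by simp [phi]⟩

lemma fA_map (p : ℕ) (c : ZMod p) : fA.map (phi p c) = fb (C c) X := by
  unfold fA
  have := map_fb (mapRingHom (phi p c)) (C X) X
  simpa [phi] using this

lemma fb_g {E : Type*} [Field E] [CharZero E] (t x : E) :
    fb t (33 * x) = 33 ^ 12 * (gP x - t * gQ x) := by
  unfold fb gP gQ
  ring

lemma fA_aeval {L : Type*} [Field L] [Algebra ℤ[X] L] [Algebra (RatFunc ℚ) L]
    [IsScalarTower ℤ[X] (RatFunc ℚ) L] (y : L) : aeval y fA = fb (tE L) y := by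
  have := map_fb ((aeval y : ℤ[X][X] →ₐ[ℤ[X]] L) : ℤ[X][X] →+* L) (C X) X
  unfold fA
  refine Eq.trans this ?_
  congr 1
  · simp only [RingHom.coe_coe, aeval_C]
    rw [IsScalarTower.algebraMap_apply ℤ[X] (RatFunc ℚ) L, algZ_apply]
    simp [tE, _root_.t]
  · simp

lemma g_deg : _root_.g.natDegree = 12 := by
  unfold _root_.g
  compute_degree!

variable (E : Type) [Field E] [Algebra (RatFunc ℚ) E]
  [Fact ((_root_.g.map (algebraMap (RatFunc ℚ) E)).Splits)]

theorem frob_g (p : ℕ) [Fact p.Prime] (c : ZMod p)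
    (hsep : (fb (C c) X : (ZMod p)[X]).Separable) :
    ∃ (k : Type) (_ : Field k) (_ : Algebra (ZMod p) k) (σ : _root_.g.Gal)
      (e : _root_.g.rootSet E ≃ {x : k // fb (algebraMap (ZMod p) k c) x = 0}),
      (∀ x, (e (σ • x) : k) = (e x : k) ^ p) ∧ Fintype.card (_root_.g.rootSet E) = 12 := by
  have := frZ
  let L := _root_.g.SplittingField
  have : CharZero L := charZero_of_injective_algebraMap (algebraMap (RatFunc ℚ) L).injective
  have : IsGalois (RatFunc ℚ) L := {}
  have hgL : ∀ x : L, fb (tE L) (33 * x) = 33 ^ 12 * aeval x _root_.g := by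
    intro x
    rw [aeval_g, fb_g]
  have hs : (fA.map (algebraMap ℤ[X] L)).Splits := by
    have h1 : fA.map (algebraMap ℤ[X] L) =
        C (33 ^ 12) * (_root_.g.map (algebraMap (RatFunc ℚ) L)).comp (C (1 / 33) * X) := by
      apply Polynomial.funext
      intro y
      rw [eval_map, ← aeval_def, fA_aeval]
      have := hgL (y / 33)
      rw [mul_div_cancel₀ _ (by norm_num)] at this
      rw [this, eval_mul, eval_C, eval_comp, eval_map, ← aeval_def]
      simp [div_eq_inv_mul]
    rw [h1]
    apply Splits.mul (Splits.C _)
    apply Splits.comp_of_natDegree_le_one (SplittingField.splits _)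
    compute_degree
  obtain ⟨k, _, _, σ, e, he, hc⟩ := frob_roots ℤ[X] (RatFunc ℚ) L p (phi p c) (phi_surj p c) fA fA_monic hs
    (by rw [fA_map]; exact hsep)
  have hg0 : _root_.g ≠ 0 := by
    intro h
    have := g_deg; rw [h] at this; simp at this
  have hmA : ∀ y : L, y ∈ fA.rootSet L ↔ fb (tE L) y = 0 := by
    intro y
    rw [mem_rootSet', fA_aeval]
    exact ⟨fun h => h.2, fun h => ⟨(fA_monic.map _).ne_zero, h⟩⟩
  have hmg : ∀ x : L, x ∈ _root_.g.rootSet L ↔ 33 * x ∈ fA.rootSet L := by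
    intro x
    rw [hmA, hgL, mem_rootSet]
    constructor
    · intro h; rw [h.2, mul_zero]
    · intro h; exact ⟨hg0, by simpa using h⟩
  let e1 : _root_.g.rootSet L ≃ fA.rootSet L :=
    (Equiv.mulLeft₀ (33 : L) (by norm_num)).subtypeEquiv hmg
  let e2 : (fA.map (phi p c)).rootSet k ≃ {x : k // fb (algebraMap (ZMod p) k c) x = 0} :=
    Equiv.subtypeEquivRight (by
      intro x
      rw [mem_rootSet', fA_map]
      have h1 : aeval x (fb (C c) X : (ZMod p)[X]) = fb (algebraMap (ZMod p) k c) x := by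
        have := map_fb ((aeval x : (ZMod p)[X] →ₐ[ZMod p] k) : (ZMod p)[X] →+* k) (C c) X
        simpa using this
      rw [h1]
      refine ⟨fun h => h.2, fun h => ⟨?_, h⟩⟩
      rw [← fA_map]
      exact ((fA_monic.map _).map _).ne_zero)
  refine ⟨k, inferInstance, inferInstance, σ,
    (Gal.rootsEquivRoots _root_.g E).symm.trans (e1.trans (e.trans e2)), ?_, ?_⟩
  · intro x
    simp only [Equiv.trans_apply]
    have hsm : (Gal.rootsEquivRoots _root_.g E).symm ((show _root_.g.Gal from σ) • x) =
        (show _root_.g.Gal from σ) • (Gal.rootsEquivRoots _root_.g E).symm x := by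
      rw [Gal.smul_def, Equiv.symm_apply_apply]
    refine (congrArg (fun z => (e2 (e (e1 z)) : k)) hsm).trans ?_
    generalize (Gal.rootsEquivRoots _root_.g E).symm x = z
    change (e (e1 ((show _root_.g.Gal from σ) • z)) : k) = (e (e1 z) : k) ^ p
    apply he
    change (33 : L) * σ (z : L) = σ (33 * (z : L))
    rw [map_mul, map_ofNat]
  · rw [fA_deg] at hc
    rw [← hc]
    exact Fintype.card_congr ((Gal.rootsEquivRoots _root_.g E).symm.trans e1)

end spec
end M11

namespace M11
open Polynomial

section lists

def ladd (p : ℕ) : List ℕ → List ℕ → List ℕ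
  | [], m => m
  | a :: l, [] => a :: l
  | a :: l, b :: m => ((a + b) % p) :: ladd p l m

def lsm (p c : ℕ) : List ℕ → List ℕ
  | [] => []
  | a :: l => ((c * a) % p) :: lsm p c l

def lmul (p : ℕ) : List ℕ → List ℕ → List ℕ
  | [], _ => []
  | a :: l, m => ladd p (lsm p a m) (0 :: lmul p l m)

def redX (p : ℕ) (nf l : List ℕ) : List ℕ := ladd p (l.take 12) (lmul p (l.drop 12) nf)

def pw (p : ℕ) (nf : List ℕ) : ℕ → List ℕ
  | 0 => [1]
  | n + 1 => redX p nf (0 :: pw p nf n)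

def mred (p : ℕ) (nf : List ℕ) : List ℕ → List ℕ → List ℕ
  | [], _ => []
  | a :: l, s => ladd p (lsm p a s) (redX p nf (0 :: mred p nf l s))

def lcomp (p : ℕ) (nf r : List ℕ) : List ℕ → List ℕ
  | [] => []
  | a :: l => ladd p [a] (mred p nf r (lcomp p nf r l))

def fit (p : ℕ) (nf r : List ℕ) : ℕ → List ℕ
  | 0 => [0, 1]
  | n + 1 => lcomp p nf r (fit p nf r n)

def ev {R : Type*} [CommRing R] : List ℕ → R → R
  | [], _ => 0
  | a :: l, x => a + x * ev l x

lemma map_ev {R S : Type*} [CommRing R] [CommRing S] (f : R →+* S) (l : List ℕ) (x : R) :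
    f (ev l x) = ev l (f x) := by
  induction l with
  | nil => simp [ev]
  | cons a l ih => simp [ev, ih]

variable {R : Type*} [CommRing R] {p : ℕ} (hp : (p : R) = 0)
include hp

lemma cast_mod' (a : ℕ) : ((a % p : ℕ) : R) = a := by
  conv_rhs => rw [← Nat.mod_add_div a p]
  push_cast
  rw [hp]; ring

lemma ev_ladd (l m : List ℕ) (x : R) : ev (ladd p l m) x = ev l x + ev m x := by
  induction l generalizing m with
  | nil => simp [ladd, ev]
  | cons a l ih =>
    cases m with
    | nil => simp [ladd, ev]
    | cons b m => simp only [ladd, ev, ih, cast_mod' hp]; push_cast; ring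

lemma ev_lsm (c : ℕ) (l : List ℕ) (x : R) : ev (lsm p c l) x = c * ev l x := by
  induction l with
  | nil => simp [lsm, ev]
  | cons a l ih => simp only [lsm, ev, ih, cast_mod' hp]; push_cast; ring

lemma ev_lmul (l m : List ℕ) (x : R) : ev (lmul p l m) x = ev l x * ev m x := by
  induction l with
  | nil => simp [lmul, ev]
  | cons a l ih => simp only [lmul, ev, ih, ev_ladd hp, ev_lsm hp]; push_cast; ring

omit hp in
lemma ev_split (n : ℕ) (l : List ℕ) (x : R) :
    ev (l.take n) x + ev (l.drop n) x * x ^ n = ev l x := by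
  induction n generalizing l with
  | zero => simp [ev]
  | succ n ih =>
    cases l with
    | nil => simp [ev]
    | cons a l => simp only [List.take_succ_cons, List.drop_succ_cons, ev, ← ih l]; ring

variable {nf : List ℕ} {x : R} (hx : x ^ 12 = ev nf x)
include hx

lemma ev_redX (l : List ℕ) : ev (redX p nf l) x = ev l x := by
  unfold redX
  rw [ev_ladd hp, ev_lmul hp, ← hx, ev_split]

lemma ev_pw (n : ℕ) : ev (pw p nf n) x = x ^ n := by
  induction n with
  | zero => simp [pw, ev]
  | succ n ih => simp only [pw, ev_redX hp hx, ev, ih]; push_cast; ring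

lemma ev_mred (l s : List ℕ) : ev (mred p nf l s) x = ev l x * ev s x := by
  induction l with
  | nil => simp [mred, ev]
  | cons a l ih => simp only [mred, ev_redX hp hx, ev, ih, ev_ladd hp, ev_lsm hp]; push_cast; ring

lemma ev_lcomp (r l : List ℕ) : ev (lcomp p nf r l) x = ev l (ev r x) := by
  induction l with
  | nil => simp [lcomp, ev]
  | cons a l ih => simp only [lcomp, ev, ih, ev_ladd hp, ev_mred hp hx]; ring

omit hp hx in
lemma ev_frob [Fact p.Prime] [CharP R p] (l : List ℕ) (x : R) : ev l (x ^ p) = ev l x ^ p := by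
  have := map_ev (frobenius R p) l x
  rw [frobenius_def, frobenius_def] at this
  exact this.symm

omit hp in
lemma ev_fit [Fact p.Prime] [CharP R p] {r : List ℕ} (hr : pw p nf p = r) (n : ℕ) :
    ev (fit p nf r n) x = x ^ (p ^ n) := by
  have hp : (p : R) = 0 := CharP.cast_eq_zero R p
  induction n with
  | zero => simp [fit, ev]
  | succ n ih =>
    have hrx : ev r x = x ^ p := by rw [← hr, ev_pw hp hx]
    rw [fit, ev_lcomp hp hx, hrx, ev_frob, ih, ← pow_mul, pow_succ]

end lists

section elt
variable (E : Type) [Field E] [Algebra (RatFunc ℚ) E]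
  [Fact ((_root_.g.map (algebraMap (RatFunc ℚ) E)).Splits)]

instance faith : FaithfulSMul (_root_.g.Gal) (_root_.g.rootSet E) := by
  constructor
  intro a b h
  apply Gal.galActionHom_injective _root_.g E
  exact Equiv.ext h

/-- the data computed at a prime -/
structure Datum (p c : ℕ) (nf r : List ℕ) (m : ℕ) : Prop where
  hf : ∀ (R : Type) [CommRing R], (p : R) = 0 → ∀ x : R, fb (c : R) x = x ^ 12 - ev nf x
  hr : pw p nf p = r
  pos : 0 < m
  hm : fit p nf r m = [0, 1, 0, 0, 0, 0, 0, 0, 0, 0, 0, 0]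

open Classical in
theorem elt {p c : ℕ} [Fact p.Prime] {nf r : List ℕ} {m : ℕ} (d : Datum p c nf r m) :
    ∃ (k : Type) (_ : Field k) (_ : CharP k p) (σ : _root_.g.Gal)
      (e : _root_.g.rootSet E ≃ {x : k // x ^ 12 = ev nf x}),
      (∀ n x, (e (σ ^ n • x) : k) = ev (fit p nf r n) (e x : k)) ∧
      Fintype.card (_root_.g.rootSet E) = 12 ∧ σ ^ m = 1 ∧
      (Finset.univ.filter (fun x : _root_.g.rootSet E => σ • x = x)).card =
        (Finset.univ.filter (fun a : ZMod p => a ^ 12 = ev nf a)).card := by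
  have hev : ∀ {R : Type} [CommRing R] (x : R), ev [0, 1, 0, 0, 0, 0, 0, 0, 0, 0, 0, 0] x = x := by
    intro R _ x; simp [ev]
  have hpp : (p : (ZMod p)[X]) = 0 := CharP.cast_eq_zero _ p
  let F : (ZMod p)[X] := fb (C (c : ZMod p)) X
  have hF : F = X ^ 12 - ev nf X := by
    have := d.hf (ZMod p)[X] hpp X
    simpa [F] using this
  have hFd : F.natDegree = 12 := by
    simp only [F]
    rw [← fA_map, fA_monic.natDegree_map, fA_deg]
  have hFdvd : F ∣ X ^ (p ^ m) - X := by
    have : Nontrivial (AdjoinRoot F) := AdjoinRoot.nontrivial F (by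
      intro h; have := natDegree_eq_of_degree_eq_some (n := 0) h; omega)
    have : CharP (AdjoinRoot F) p :=
      charP_of_injective_algebraMap (algebraMap (ZMod p) (AdjoinRoot F)).injective p
    have h0 : AdjoinRoot.mk F F = 0 := AdjoinRoot.mk_self
    rw [← AdjoinRoot.mk_eq_zero, map_sub, map_pow, AdjoinRoot.mk_X]
    have hx : (AdjoinRoot.root F) ^ 12 = ev nf (AdjoinRoot.root F) := by
      have h1 : AdjoinRoot.mk F (X ^ 12 - ev nf X) = 0 := by rw [← hF, h0]
      rw [map_sub, map_pow, AdjoinRoot.mk_X, map_ev, AdjoinRoot.mk_X] at h1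
      exact sub_eq_zero.1 h1
    rw [← ev_fit hx d.hr m, d.hm, hev, sub_self]
  have hsep : F.Separable := (galois_poly_separable p (p ^ m) (dvd_pow_self p d.pos.ne')).of_dvd hFdvd
  obtain ⟨k, _, _, σ, e, he, hc⟩ := frob_g E p (c : ZMod p) hsep
  have hk : CharP k p := charP_of_injective_algebraMap (algebraMap (ZMod p) k).injective p
  have hiff : ∀ x : k, fb (algebraMap (ZMod p) k c) x = 0 ↔ x ^ 12 = ev nf x := by
    intro x
    rw [map_natCast, d.hf k (CharP.cast_eq_zero k p), sub_eq_zero]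
  let e' := e.trans (Equiv.subtypeEquivRight hiff)
  have he' : ∀ x, (e' (σ • x) : k) = (e' x : k) ^ p := he
  have hn : ∀ n x, (e' (σ ^ n • x) : k) = (e' x : k) ^ (p ^ n) := by
    intro n
    induction n with
    | zero => simp
    | succ n ih =>
      intro x
      rw [pow_succ' σ, mul_smul, he', ih, ← pow_mul, pow_succ]
  have hn' : ∀ n x, (e' (σ ^ n • x) : k) = ev (fit p nf r n) (e' x : k) := by
    intro n x
    rw [hn, ev_fit (e' x).2 d.hr n]
  refine ⟨k, inferInstance, hk, σ, e', hn', hc, ?_, ?_⟩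
  · apply FaithfulSMul.eq_of_smul_eq_smul (α := _root_.g.rootSet E)
    intro x
    apply e'.injective
    apply Subtype.ext
    rw [hn', d.hm, hev, one_smul]
  · symm
    apply Finset.card_bij (fun a ha => e'.symm ⟨algebraMap (ZMod p) k a, by
      have := (Finset.mem_filter.1 ha).2
      rw [← map_pow, this, map_ev]⟩)
    · intro a ha
      simp only [Finset.mem_filter, Finset.mem_univ, true_and]
      apply e'.injective
      apply Subtype.ext
      rw [he', Equiv.apply_symm_apply]
      change algebraMap (ZMod p) k a ^ p = algebraMap (ZMod p) k a
      rw [← map_pow, ZMod.pow_card]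
    · intro a ha b hb h
      have := congrArg Subtype.val (e'.symm.injective h)
      exact (algebraMap (ZMod p) k).injective this
    · intro x hx
      have hx' := (Finset.mem_filter.1 hx).2
      have h1 : (e' x : k) ^ p = e' x := by rw [← he', hx']
      rw [← Subfield.mem_bot_iff_pow_eq_self, ← ZMod.fieldRange_castHom_eq_bot p] at h1
      obtain ⟨a, ha⟩ := h1
      have ha' : algebraMap (ZMod p) k a = e' x := by
        rw [← ha]; congr 1; exact Subsingleton.elim _ _
      refine ⟨a, ?_, ?_⟩
      · simp only [Finset.mem_filter, Finset.mem_univ, true_and]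
        apply (algebraMap (ZMod p) k).injective
        rw [map_pow, map_ev, ha']
        exact (e' x).2
      · rw [Equiv.symm_apply_eq]
        exact Subtype.ext ha'

end elt
end M11

namespace M11
open Polynomial

def nfTh : List ℕ := [8, 16, 8, 3, 10, 12, 14, 16, 6, 18, 13, 12]
def rTh : List ℕ := [12, 7, 10, 7, 2, 10, 16, 0, 4, 12, 17, 7]

theorem datTh : Datum 19 7 nfTh rTh 3 where
  hf R _ hp x := by
    have hp' : (19 : R) = 0 := by exact_mod_cast hp
    simp only [fb, nfTh, ev]
    push_cast
    linear_combination ((-275804132187682) * x ^ 0 + (-9629525036855) * x ^ 1 + (9568961986310) * x ^ 2 + (40375367031) * x ^ 3 + (-70758850301) * x ^ 4 + (655002894) * x ^ 5 + (264106688) * x ^ 6 + (-2136044) * x ^ 7 + (-383748) * x ^ 8 + (16043) * x ^ 9 + (1147) * x ^ 10 + (18) * x ^ 11) * hp'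
  hr := by decide +kernel
  pos := by norm_num
  hm := by decide +kernel

theorem cntTh : (Finset.univ.filter (fun a : ZMod 19 => a ^ 12 = ev nfTh a)).card = 3 := by
  decide +kernel

def nfKa : List ℕ := [6, 8, 9, 3, 13, 6, 13, 4, 16, 16, 13, 12]
def rKa : List ℕ := [17, 1, 4, 2, 15, 13, 2, 14, 14, 9, 2, 6]

theorem datKa : Datum 19 2 nfKa rKa 4 where
  hf R _ hp x := by
    have hp' : (19 : R) = 0 := by exact_mod_cast hp
    simp only [fb, nfKa, ev]
    push_cast
    linear_combination ((533621038363125) * x ^ 0 + (-34157560508092) * x ^ 1 + (-6783061661181) * x ^ 2 + (40375367031) * x ^ 3 + (39355787056) * x ^ 4 + (2323406490) * x ^ 5 + (-44856941) * x ^ 6 + (-9626072) * x ^ 7 + (-71663) * x ^ 8 + (25500) * x ^ 9 + (1147) * x ^ 10 + (18) * x ^ 11) * hp'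
  hr := by decide +kernel
  pos := by norm_num
  hm := by decide +kernel

theorem cntKa : (Finset.univ.filter (fun a : ZMod 19 => a ^ 12 = ev nfKa a)).card = 0 := by
  decide +kernel

def nfRh : List ℕ := [0, 3, 12, 3, 3, 7, 10, 6, 8, 10, 13, 12]
def rRh : List ℕ := [0, 12, 15, 15, 0, 5, 7, 9, 7, 4, 2, 8]

theorem datRh : Datum 19 6 nfRh rRh 5 where
  hf R _ hp x := by
    have hp' : (19 : R) = 0 := by exact_mod_cast hp
    simp only [fb, nfRh, ev]
    push_cast
    linear_combination ((-113919098077521) * x ^ 0 + (-14535132131103) * x ^ 1 + (6298557256812) * x ^ 2 + (40375367031) * x ^ 3 + (-48735922830) * x ^ 4 + (988683613) * x ^ 5 + (202313962) * x ^ 6 + (-3634050) * x ^ 7 + (-321331) * x ^ 8 + (17934) * x ^ 9 + (1147) * x ^ 10 + (18) * x ^ 11) * hp'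
  hr := by decide +kernel
  pos := by norm_num
  hm := by decide +kernel

theorem cntRh : (Finset.univ.filter (fun a : ZMod 19 => a ^ 12 = ev nfRh a)).card = 2 := by
  decide +kernel

def nfSi : List ℕ := [17, 14, 13, 3, 6, 1, 9, 13, 18, 8, 13, 12]
def rSi : List ℕ := [10, 15, 18, 1, 4, 18, 4, 0, 9, 13, 9, 4]

theorem datSi : Datum 19 1 nfSi rSi 11 where
  hf R _ hp x := by
    have hp' : (19 : R) = 0 := by exact_mod_cast hp
    simp only [fb, nfSi, ev]
    push_cast
    linear_combination ((695506072473287) * x ^ 0 + (-39063167602339) * x ^ 1 + (-10053466390679) * x ^ 2 + (40375367031) * x ^ 3 + (61378714527) * x ^ 4 + (2657087209) * x ^ 5 + (-106649667) * x ^ 6 + (-11124077) * x ^ 7 + (-9246) * x ^ 8 + (27391) * x ^ 9 + (1147) * x ^ 10 + (18) * x ^ 11) * hp'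
  hr := by decide +kernel
  pos := by norm_num
  hm := by decide +kernel

theorem cntSi : (Finset.univ.filter (fun a : ZMod 19 => a ^ 12 = ev nfSi a)).card = 1 := by
  decide +kernel


lemma ev_X_zero {k : Type*} [Field k] (l : List ℕ) (h : ev l (X : k[X]) = 0) :
    ∀ a ∈ l, (a : k) = 0 := by
  induction l with
  | nil => simp
  | cons b l ih =>
    simp only [ev] at h
    have h0 : (b : k) = 0 := by
      have := congrArg (fun q => coeff q 0) h
      simpa using this
    have hb : ((b : ℕ) : k[X]) = 0 := by rw [← C_eq_natCast, h0, C_0]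
    rw [hb, zero_add] at h
    have h1 := (mul_eq_zero.1 h).resolve_left X_ne_zero
    intro a ha
    rcases List.mem_cons.1 ha with rfl | ha
    · exact h0
    · exact ih h1 a ha

lemma ev_X_deg {k : Type*} [Field k] (l : List ℕ) : (ev l (X : k[X])).degree < l.length := by
  induction l with
  | nil => simp [ev]
  | cons b l ih =>
    simp only [ev, List.length_cons]
    refine lt_of_le_of_lt (degree_add_le _ _) (max_lt ?_ ?_)
    · rw [← C_eq_natCast]
      refine lt_of_le_of_lt degree_C_le ?_
      exact_mod_cast Nat.succ_pos _
    · rw [X_mul, degree_mul_X]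
      push_cast
      exact WithBot.add_lt_add_right (by simp) ih

lemma ev_roots {k : Type*} [Field k] (l : List ℕ) (S : Finset k) (h : ∀ x ∈ S, ev l x = 0)
    (hl : l.length ≤ S.card) : ∀ a ∈ l, (a : k) = 0 := by
  apply ev_X_zero
  apply eq_zero_of_degree_lt_of_eval_finset_eq_zero S
  · exact lt_of_lt_of_le (ev_X_deg l) (by exact_mod_cast hl)
  · intro x hx
    rw [← coe_evalRingHom, map_ev, coe_evalRingHom, eval_X, h x hx]

section elts
open Classical
variable (E : Type) [Field E] [Algebra (RatFunc ℚ) E]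
  [Fact ((_root_.g.map (algebraMap (RatFunc ℚ) E)).Splits)]

instance fact19 : Fact (Nat.Prime 19) := ⟨by norm_num⟩

theorem ex_k : ∃ κ : _root_.g.Gal, κ ^ 4 = 1 ∧ κ ^ 2 ≠ 1 ∧ (∀ x : _root_.g.rootSet E, κ • x ≠ x) ∧
    3 ≤ (Finset.univ.filter (fun x : _root_.g.rootSet E => κ ^ 2 • x = x)).card := by
  obtain ⟨k, _, _, σ, e, hn, hc, hm, hF⟩ := elt E datKa
  have hp : ((19 : ℕ) : k) = 0 := CharP.cast_eq_zero k 19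
  have hz : ∀ a : ℕ, (a : k) = 0 → 19 ∣ a := fun a => (CharP.cast_eq_zero_iff k 19 a).1
  rw [cntKa, Finset.card_eq_zero, Finset.filter_eq_empty_iff] at hF
  have hj : Function.Injective (fun x => (e x : k)) := Subtype.val_injective.comp e.injective
  have hn2 := hn 2
  rw [show fit 19 nfKa rKa 2 = [7, 12, 4, 0, 0, 12, 16, 16, 15, 9, 4, 10] by decide +kernel] at hn2
  refine ⟨σ, hm, ?_, fun x => hF (Finset.mem_univ x), ?_⟩
  · intro h
    have := ev_roots (k := k) [7, 11, 4, 0, 0, 12, 16, 16, 15, 9, 4, 10] (Finset.univ.image (fun x => (e x : k))) (by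
      intro y hy
      obtain ⟨x, -, rfl⟩ := Finset.mem_image.1 hy
      have h1 := hn2 x
      rw [h, one_smul] at h1
      have h2 := ev_ladd hp [7, 12, 4, 0, 0, 12, 16, 16, 15, 9, 4, 10] [0, 18] (e x : k)
      rw [show ladd 19 [7, 12, 4, 0, 0, 12, 16, 16, 15, 9, 4, 10] [0, 18] = [7, 11, 4, 0, 0, 12, 16, 16, 15, 9, 4, 10] by decide +kernel, ← h1] at h2
      rw [h2]
      simp only [ev]
      push_cast at hp ⊢
      linear_combination (e x : k) * hp) (by
      rw [Finset.card_image_of_injective _ hj, Finset.card_univ, hc]; decide)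
    have := hz _ (this 7 (by decide))
    revert this; decide
  · by_contra hlt
    have hd : ∀ x, ev [12, 12, 0, 14, 1] (e x : k) * ev [9, 3, 1, 12, 8, 17, 9, 12, 1] (e x : k) = 0 := by
      intro x
      have h2 := ev_ladd hp nfKa (lmul 19 [12, 12, 0, 14, 1] [9, 3, 1, 12, 8, 17, 9, 12, 1]) (e x : k)
      rw [show ladd 19 nfKa (lmul 19 [12, 12, 0, 14, 1] [9, 3, 1, 12, 8, 17, 9, 12, 1]) = [0,0,0,0,0,0,0,0,0,0,0,0,1] by decide +kernel,
        ev_lmul hp, ← (e x).2] at h2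
      simp only [ev] at h2 ⊢
      push_cast at h2 ⊢
      linear_combination -h2
    have hfx : ∀ x, σ ^ 2 • x ≠ x → ev [9, 3, 1, 12, 8, 17, 9, 12, 1] (e x : k) = 0 := by
      intro x hx
      refine (mul_eq_zero.1 (hd x)).resolve_left fun h => hx (hj ?_)
      change (e (σ ^ 2 • x) : k) = e x
      rw [hn2, show ([7, 12, 4, 0, 0, 12, 16, 16, 15, 9, 4, 10] : List ℕ) = ladd 19 [0, 1] (lmul 19 [12, 12, 0, 14, 1] [18, 13, 0, 17, 17, 13, 16, 10]) by decide +kernel,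
        ev_ladd hp, ev_lmul hp, h]
      simp [ev]
    have hs := Finset.card_filter_add_card_filter_not (s := (Finset.univ : Finset (_root_.g.rootSet E)))
      (fun x => σ ^ 2 • x = x)
    rw [Finset.card_univ, hc] at hs
    have := ev_roots (k := k) [9, 3, 1, 12, 8, 17, 9, 12, 1]
      ((Finset.univ.filter (fun x => ¬ σ ^ 2 • x = x)).image (fun x => (e x : k))) (by
      intro y hy
      obtain ⟨x, hx, rfl⟩ := Finset.mem_image.1 hy
      exact hfx x (Finset.mem_filter.1 hx).2) (by
      rw [Finset.card_image_of_injective _ hj]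
      simp only [List.length_cons, List.length_nil]
      omega)
    have := hz _ (this 1 (by decide))
    revert this; decide

theorem elts : Elts (_root_.g.Gal) (_root_.g.rootSet E) where
  card := by
    obtain ⟨k, _, _, σ, e, hn, hc, hm, hF⟩ := elt E datSi
    exact hc
  s := by
    obtain ⟨k, _, _, σ, e, hn, hc, hm, hF⟩ := elt E datSi
    refine ⟨σ, hm, ?_⟩
    rintro rfl
    rw [cntSi] at hF
    simp only [one_smul, Finset.filter_true, Finset.card_univ, hc] at hF
    omega
  r := by
    obtain ⟨k, _, _, σ, e, hn, hc, hm, hF⟩ := elt E datRh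
    exact ⟨σ, hm, by rw [cntRh] at hF; convert hF⟩
  th := by
    obtain ⟨k, _, _, σ, e, hn, hc, hm, hF⟩ := elt E datTh
    exact ⟨σ, hm, by rw [cntTh] at hF; convert hF⟩
  k := by
    obtain ⟨σ, h1, h2, h3, h4⟩ := ex_k E
    exact ⟨σ, h1, h2, h3, by convert h4⟩

end elts
end M11

namespace M11
open Classical in
theorem final_of (E : Type) [Field E] [Algebra (RatFunc ℚ) E] [IsAlgClosed E]
    [Normal (RatFunc ℚ) E] :
    _root_.g.natDegree = 12 ∧ IsSimpleGroup _root_.g.Gal ∧ Nat.card _root_.g.Gal = 7920 := by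
  let _ : Algebra ℚ E :=
    ((algebraMap (RatFunc ℚ) E).comp (algebraMap ℚ (RatFunc ℚ))).toAlgebra
  have : IsScalarTower ℚ (RatFunc ℚ) E := by
    constructor
    intro a b c
    rw [RatFunc.smul_eq_C_mul, Algebra.smul_def, Algebra.smul_def, Algebra.smul_def, map_mul, mul_assoc]
    congr 1
    change algebraMap (RatFunc ℚ) E (RatFunc.C a) = algebraMap (RatFunc ℚ) E (algebraMap ℚ (RatFunc ℚ) a)
    congr 1
    exact congrArg (fun f : ℚ →+* RatFunc ℚ => f a) (Subsingleton.elim _ _)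
  have : Fact ((_root_.g.map (algebraMap (RatFunc ℚ) E)).Splits) := ⟨IsAlgClosed.splits _⟩
  have h := elts E
  obtain ⟨S, b⟩ := blocks_ex (E := E) h.card
  obtain ⟨h1, h2⟩ := core h b
  exact ⟨g_deg, h2, h1⟩

theorem final :
    _root_.g.natDegree = 12 ∧ IsSimpleGroup _root_.g.Gal ∧ Nat.card _root_.g.Gal = 7920 :=
  final_of (AlgebraicClosure (RatFunc ℚ))
end M11

theorem m11_five_branch_points_g :
    g.natDegree = 12 ∧ IsSimpleGroup g.Gal ∧ Nat.card g.Gal = 7920 := by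
  exact M11.final
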